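/- Proposition 3 (moment bound for the empirical covariance of a Hilbert-valued dependent Gaussian process): let {x_t}_{t=1}^n be an ℍ-valued centered stationary Gaussian process whose cross-covariance operators Σ_h (defined by Σ_h u := 𝔼[⟨x_{t+h}, u⟩ x_t]) are trace class for all h ∈ ℤ. Then 𝔼[‖Σ̂₀ − Σ₀‖] ≤ (2√2/n)·( √2·tr(Σ̄_n) + √(2n·‖Σ₀‖·tr(Σ̄_n)) + √(n·tr(Σ₀)·‖Σ̄_n‖) ). -/

import Mathlib

open MeasureTheory ProbabilityTheory
open scoped ENNReal NNReal BigOperators RealInnerProductSpace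

noncomputable section

namespace TS

variable {H : Type*} [NormedAddCommGroup H] [InnerProductSpace ℝ H] [CompleteSpace H]

/-- Operator norm of a (not necessarily linear, in general the difference of two
covariance operators) map `T : H → H`: `sup_{‖u‖ = 1} ‖T u‖`. -/
def opNormH (T : H → H) : ℝ := sSup {r | ∃ u : H, ‖u‖ = 1 ∧ r = ‖T u‖}

/-- A centered (jointly) Gaussian `H`-valued process: every finite linear functional
combination of the `x_t` is a centered real Gaussian. -/
def IsCenteredGaussianProcess {Ω : Type*} [MeasureSpace Ω] (x : ℤ → Ω → H) : Prop :=
  ∀ (m : ℕ) (ts : Fin m → ℤ) (us : Fin m → H),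
    ∃ v : ℝ≥0,
      Measure.map (fun ω => ∑ j, ⟪us j, x (ts j) ω⟫) ℙ = gaussianReal 0 v

/-- (Covariance) stationarity of a centered Gaussian process. -/
def IsCovStationary {Ω : Type*} [MeasureSpace Ω] (x : ℤ → Ω → H) : Prop :=
  ∀ (t h : ℤ) (u v : H),
    (∫ ω, ⟪x (t + h) ω, u⟫ * ⟪x t ω, v⟫) = ∫ ω, ⟪x h ω, u⟫ * ⟪x 0 ω, v⟫

/-- The covariance operator `Σ₀`, given through the singular value data
`Σ_h u = Σ_i σ_i(Σ_h) ⟨f_{h,i}, u⟩ g_{h,i}` at `h = 0`. -/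
def Sig0Fun (σ : ℤ → ℕ → ℝ) (f g : ℤ → ℕ → H) (u : H) : H :=
  ∑' i, (σ 0 i * ⟪f 0 i, u⟫) • g 0 i

/-- The symmetrized positive part
`Σ̃_h u = (1/2) Σ_i σ_i(Σ_h)(⟨f_{h,i},u⟩ f_{h,i} + ⟨g_{h,i},u⟩ g_{h,i})`. -/
def SigTildeFun (σ : ℤ → ℕ → ℝ) (f g : ℤ → ℕ → H) (h : ℤ) (u : H) : H :=
  (1 / 2 : ℝ) • ∑' i, σ h i • ((⟪f h i, u⟫) • f h i + (⟪g h i, u⟫) • g h i)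

/-- The integrated covariance `Σ̄_n u = Σ₀ u + 2 Σ_{h=1}^{n-1} Σ̃_h u`. -/
def SigBarFun (σ : ℤ → ℕ → ℝ) (f g : ℤ → ℕ → H) (n : ℕ) (u : H) : H :=
  Sig0Fun σ f g u + (2 : ℝ) • ∑ h ∈ Finset.Ico 1 n, SigTildeFun σ f g (h : ℤ) u

/-- The empirical covariance operator `Σ̂₀ u = (1/n) Σ_{t=1}^n ⟨x_t, u⟩ x_t`. -/
def hatSigFun {Ω : Type*} (n : ℕ) (x : ℤ → Ω → H) (ω : Ω) (u : H) : H :=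
  (1 / (n : ℝ)) • ∑ t ∈ Finset.Icc (1 : ℤ) (n : ℤ), (⟪x t ω, u⟫) • x t ω

/-- `tr(Σ₀) = Σ_i σ_i(Σ₀)`. -/
def trSig0 (σ : ℤ → ℕ → ℝ) : ℝ := ∑' i, σ 0 i

/-- `tr(Σ̄_n) = tr(Σ₀) + 2 Σ_{h=1}^{n-1} tr(Σ̃_h)`, with `tr(Σ̃_h) = Σ_i σ_i(Σ_h)`. -/
def trSigBar (σ : ℤ → ℕ → ℝ) (n : ℕ) : ℝ :=
  trSig0 σ + 2 * ∑ h ∈ Finset.Ico 1 n, ∑' i, σ (h : ℤ) i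

/-- The Hilbert–Schmidt norm `‖X‖_HS = √(Σ_{t=1}^n ‖x_t‖²)` of the sample. -/
def hsNorm {Ω : Type*} (n : ℕ) (x : ℤ → Ω → H) (ω : Ω) : ℝ :=
  Real.sqrt (∑ t ∈ Finset.Icc (1 : ℤ) (n : ℤ), ‖x t ω‖ ^ 2)

end TS

open TS
open scoped RealInnerProductSpace

set_option linter.unusedSectionVars false

section GaussianIntegration

variable {E : Type*} [NormedAddCommGroup E] [NormedSpace ℝ E] [MeasurableSpace E] [BorelSpace E]
  [SecondCountableTopology E] [CompleteSpace E]

theorem integrable_one_add_norm_pow (ρ : Measure E) [IsGaussian ρ] (k : ℕ) :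
    Integrable (fun x => (1 + ‖x‖) ^ k) ρ := by
  have h1 : MemLp (fun x : E => 1 + ‖x‖) k ρ :=
    (memLp_const (1 : ℝ)).add (IsGaussian.memLp_id ρ k (by simp)).norm
  refine h1.integrable_norm_pow'.congr (ae_of_all _ fun x => ?_)
  simp only [Real.norm_eq_abs]
  rw [abs_of_nonneg (by positivity)]

theorem integrable_of_polynomial_growth {ρ : Measure E} [IsGaussian ρ] {f : E → ℝ}
    (hf : Continuous f) (C : ℝ) (k : ℕ) (h : ∀ x, |f x| ≤ C * (1 + ‖x‖) ^ k) :
    Integrable f ρ :=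
  ((integrable_one_add_norm_pow ρ k).const_mul C).mono' hf.aestronglyMeasurable
    (ae_of_all _ fun x => by simpa using h x)

/-- Gaussian integration by parts, obtained by differentiating the rotation invariance of
`ρ.prod ρ` at angle zero. -/
theorem gaussian_integration_by_parts {ρ : Measure E} [IsGaussian ρ]
    (h0 : ∀ L : StrongDual ℝ E, ρ[L] = 0) (l : StrongDual ℝ E)
    {G : E → ℝ} {DG : E → StrongDual ℝ E} (hG : ∀ x, HasFDerivAt G (DG x) x)
    (hDG : Continuous DG) {C : ℝ} (hC : ∀ x, |G x| ≤ C) (hC' : ∀ x, ‖DG x‖ ≤ C) :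
    ∫ x, G x * l x ∂ρ = ∫ z, DG z.1 z.2 * l z.2 ∂(ρ.prod ρ) := by
  have hGc : Continuous G := continuous_iff_continuousAt.2 fun x => (hG x).continuousAt
  have hC0 : 0 ≤ C := (abs_nonneg _).trans (hC 0)
  set F : ℝ → E × E → ℝ := fun θ z =>
    G (Real.cos θ • z.1 + Real.sin θ • z.2) * l (-Real.sin θ • z.1 + Real.cos θ • z.2) with hF
  set F' : ℝ → E × E → ℝ := fun θ z =>
    DG (Real.cos θ • z.1 + Real.sin θ • z.2) (-Real.sin θ • z.1 + Real.cos θ • z.2) *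
      l (-Real.sin θ • z.1 + Real.cos θ • z.2) +
    G (Real.cos θ • z.1 + Real.sin θ • z.2) * l (-Real.cos θ • z.1 + -Real.sin θ • z.2) with hF'
  have hrot : ∀ θ, ∫ z, F θ z ∂(ρ.prod ρ) = ∫ z, G z.1 * l z.2 ∂(ρ.prod ρ) := by
    intro θ
    conv_rhs => rw [← IsGaussian.map_rotation_eq_self_of_forall_strongDual_eq_zero h0 θ]
    rw [integral_map (by fun_prop)
      (Continuous.aestronglyMeasurable (by fun_prop))]
    rfl
  have bnd1 : ∀ θ (z : E × E), ‖-Real.sin θ • z.1 + Real.cos θ • z.2‖ ≤ 2 * (1 + ‖z‖) := by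
    intro θ z
    refine (norm_add_le _ _).trans ?_
    rw [norm_smul, norm_smul]
    have h1 := norm_fst_le z
    have h2 := norm_snd_le z
    have h3 : ‖-Real.sin θ‖ ≤ 1 := by simpa using Real.abs_sin_le_one θ
    have h4 : ‖Real.cos θ‖ ≤ 1 := by simpa using Real.abs_cos_le_one θ
    nlinarith [norm_nonneg z.1, norm_nonneg z.2, norm_nonneg z]
  have bnd2 : ∀ θ (z : E × E), ‖-Real.cos θ • z.1 + -Real.sin θ • z.2‖ ≤ 2 * (1 + ‖z‖) := by
    intro θ z
    refine (norm_add_le _ _).trans ?_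
    rw [norm_smul, norm_smul]
    have h1 := norm_fst_le z
    have h2 := norm_snd_le z
    have h3 : ‖-Real.sin θ‖ ≤ 1 := by simpa using Real.abs_sin_le_one θ
    have h4 : ‖-Real.cos θ‖ ≤ 1 := by simpa using Real.abs_cos_le_one θ
    nlinarith [norm_nonneg z.1, norm_nonneg z.2, norm_nonneg z]
  have hbound : ∀ θ z, ‖F' θ z‖ ≤ (4 * C * ‖l‖ + 2 * C * ‖l‖) * (1 + ‖z‖) ^ 2 := by
    intro θ z
    refine (norm_add_le _ _).trans ?_
    rw [norm_mul, norm_mul]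
    have e1 := (DG (Real.cos θ • z.1 + Real.sin θ • z.2)).le_of_opNorm_le_of_le (hC' _) (bnd1 θ z)
    have e2 := l.le_of_opNorm_le_of_le le_rfl (bnd1 θ z)
    have e3 := l.le_of_opNorm_le_of_le le_rfl (bnd2 θ z)
    have e4 : ‖G (Real.cos θ • z.1 + Real.sin θ • z.2)‖ ≤ C := hC _
    have f1 := mul_le_mul e1 e2 (norm_nonneg _) (by positivity)
    have f2 := mul_le_mul e4 e3 (norm_nonneg _) hC0
    have f3 : C * ‖l‖ * (1 + ‖z‖) ≤ C * ‖l‖ * (1 + ‖z‖) ^ 2 := by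
      apply mul_le_mul_of_nonneg_left _ (by positivity)
      nlinarith [norm_nonneg z]
    nlinarith
  have key := hasDerivAt_integral_of_dominated_loc_of_deriv_le (μ := ρ.prod ρ) (F := F) (F' := F')
    (x₀ := (0 : ℝ)) (s := Set.univ) (bound := fun z => (4 * C * ‖l‖ + 2 * C * ‖l‖) * (1 + ‖z‖) ^ 2)
    Filter.univ_mem (Filter.Eventually.of_forall fun θ =>
      Continuous.aestronglyMeasurable (by fun_prop))
    (integrable_of_polynomial_growth (by fun_prop) (2 * C * ‖l‖) 1 (fun z => by
      rw [hF]; simp only [abs_mul]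
      have e2 := l.le_of_opNorm_le_of_le le_rfl (bnd1 0 z)
      have := mul_le_mul (hC (Real.cos 0 • z.1 + Real.sin 0 • z.2)) e2 (norm_nonneg _) hC0
      refine this.trans (le_of_eq (by ring))))
    (Continuous.aestronglyMeasurable (by fun_prop))
    (ae_of_all _ fun z θ _ => hbound θ z)
    ((integrable_one_add_norm_pow _ 2).const_mul _)
    (ae_of_all _ fun z θ _ => by
      have c1 : HasDerivAt (fun θ : ℝ => Real.cos θ • z.1 + Real.sin θ • z.2)
          (-Real.sin θ • z.1 + Real.cos θ • z.2) θ :=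
        ((Real.hasDerivAt_cos θ).smul_const _).add ((Real.hasDerivAt_sin θ).smul_const _)
      have c2 : HasDerivAt (fun θ : ℝ => -Real.sin θ • z.1 + Real.cos θ • z.2)
          (-Real.cos θ • z.1 + -Real.sin θ • z.2) θ :=
        ((Real.hasDerivAt_sin θ).neg.smul_const _).add ((Real.hasDerivAt_cos θ).smul_const _)
      exact ((hG _).comp_hasDerivAt θ c1).mul (l.hasFDerivAt.comp_hasDerivAt θ c2))
  have hzero : ∫ z, F' 0 z ∂(ρ.prod ρ) = 0 := by
    have h1 := key.2
    simp_rw [hrot] at h1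
    exact h1.unique (hasDerivAt_const _ _)
  have i1 : Integrable (fun z : E × E => DG z.1 z.2 * l z.2) (ρ.prod ρ) := by
    refine integrable_of_polynomial_growth (by fun_prop) (C * ‖l‖) 2 fun z => ?_
    rw [abs_mul]
    have h2 : ‖z.2‖ ≤ 1 + ‖z‖ := (norm_snd_le z).trans (by linarith [norm_nonneg z])
    have e1 := (DG z.1).le_of_opNorm_le_of_le (hC' z.1) h2
    have e2 := l.le_of_opNorm_le_of_le le_rfl h2
    refine (mul_le_mul e1 e2 (norm_nonneg _) (by positivity)).trans (le_of_eq (by ring))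
  have i2 : Integrable (fun z : E × E => G z.1 * l z.1) (ρ.prod ρ) := by
    refine integrable_of_polynomial_growth (by fun_prop) (C * ‖l‖) 1 fun z => ?_
    rw [abs_mul]
    have h2 : ‖z.1‖ ≤ 1 + ‖z‖ := (norm_fst_le z).trans (by linarith [norm_nonneg z])
    have e2 := l.le_of_opNorm_le_of_le le_rfl h2
    refine (mul_le_mul (hC _) e2 (norm_nonneg _) hC0).trans (le_of_eq (by ring))
  have hsplit : ∫ z, F' 0 z ∂(ρ.prod ρ) =
      (∫ z, DG z.1 z.2 * l z.2 ∂(ρ.prod ρ)) - ∫ z, G z.1 * l z.1 ∂(ρ.prod ρ) := by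
    rw [← integral_sub i1 i2]
    congr 1
    ext z
    simp [hF', sub_eq_add_neg]
  have hfst : ∫ z, G z.1 * l z.1 ∂(ρ.prod ρ) = ∫ x, G x * l x ∂ρ := by
    have := integral_fun_fst (μ := ρ) (ν := ρ) (fun x => G x * l x)
    simpa using this
  linarith

end GaussianIntegration

section SudakovFernique

variable {E : Type*} [NormedAddCommGroup E] [NormedSpace ℝ E] [MeasurableSpace E] [BorelSpace E]
  [SecondCountableTopology E] [CompleteSpace E]
variable {F : Type*} [NormedAddCommGroup F] [NormedSpace ℝ F] [MeasurableSpace F] [BorelSpace F]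
  [SecondCountableTopology F] [CompleteSpace F]

theorem integrable_dual_mul_dual (ρ : Measure E) [IsGaussian ρ] (L L' : StrongDual ℝ E) :
    Integrable (fun x => L x * L' x) ρ :=
  (IsGaussian.memLp_dual ρ L 2 (by simp)).integrable_mul (IsGaussian.memLp_dual ρ L' 2 (by simp))

theorem integral_dual_sub_sq (ρ : Measure E) [IsGaussian ρ] (L L' : StrongDual ℝ E) :
    ∫ x, (L x - L' x) ^ 2 ∂ρ =
      (∫ x, L x * L x ∂ρ) + (∫ x, L' x * L' x ∂ρ) - 2 * ∫ x, L x * L' x ∂ρ := by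
  have i1 := integrable_dual_mul_dual ρ L L
  have i2 := integrable_dual_mul_dual ρ L' L'
  have i3 := integrable_dual_mul_dual ρ L L'
  have i4 : Integrable (fun x => L x * L x + L' x * L' x) ρ := i1.add i2
  have e : ∀ x, (L x - L' x) ^ 2 = (L x * L x + L' x * L' x) - 2 * (L x * L' x) := fun x => by ring
  simp_rw [e]
  rw [integral_sub i4 (i3.const_mul 2), integral_add i1 i2, integral_const_mul]

theorem integral_dual_prod_eq_zero {μ : Measure E} {ν : Measure F} [IsGaussian μ] [IsGaussian ν]
    (hμ : ∀ L : StrongDual ℝ E, μ[L] = 0) (hν : ∀ L : StrongDual ℝ F, ν[L] = 0)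
    (L : StrongDual ℝ (E × F)) : (μ.prod ν)[L] = 0 := by
  have h : ∀ z : E × F, L z = (L.comp (ContinuousLinearMap.inl ℝ E F)) z.1 +
      (L.comp (ContinuousLinearMap.inr ℝ E F)) z.2 := by
    intro z
    simp [← map_add]
  simp_rw [h]
  rw [integral_add]
  · rw [integral_fun_fst (μ := μ) (ν := ν) (fun x => (L.comp (ContinuousLinearMap.inl ℝ E F)) x),
      integral_fun_snd (μ := μ) (ν := ν) (fun x => (L.comp (ContinuousLinearMap.inr ℝ E F)) x),
      hμ, hν]
    simp
  · exact (IsGaussian.integrable_dual μ _).comp_fst _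
  · exact (IsGaussian.integrable_dual ν _).comp_snd _

theorem integral_prod_mul_combination {μ : Measure E} {ν : Measure F} [IsGaussian μ] [IsGaussian ν]
    (hμ : ∀ L : StrongDual ℝ E, μ[L] = 0)
    (L L' : StrongDual ℝ E) (M M' : StrongDual ℝ F) (a b a' b' : ℝ) :
    ∫ z, (a * L z.1 + b * M z.2) * (a' * L' z.1 + b' * M' z.2) ∂(μ.prod ν) =
      a * a' * ∫ x, L x * L' x ∂μ + b * b' * ∫ y, M y * M' y ∂ν := by
  have i1 : Integrable (fun z : E × F => L z.1 * L' z.1) (μ.prod ν) :=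
    (integrable_dual_mul_dual μ L L').comp_fst ν
  have i2 : Integrable (fun z : E × F => M z.2 * M' z.2) (μ.prod ν) :=
    (integrable_dual_mul_dual ν M M').comp_snd μ
  have i3 : Integrable (fun z : E × F => L z.1 * M' z.2) (μ.prod ν) :=
    (IsGaussian.integrable_dual μ L).mul_prod (IsGaussian.integrable_dual ν M')
  have i4 : Integrable (fun z : E × F => L' z.1 * M z.2) (μ.prod ν) :=
    (IsGaussian.integrable_dual μ L').mul_prod (IsGaussian.integrable_dual ν M)
  have e : ∀ z : E × F, (a * L z.1 + b * M z.2) * (a' * L' z.1 + b' * M' z.2) =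
      ((a * a') * (L z.1 * L' z.1) + (b * b') * (M z.2 * M' z.2)) +
      ((a * b') * (L z.1 * M' z.2) + (b * a') * (L' z.1 * M z.2)) := fun z => by ring
  simp_rw [e]
  have i5 : Integrable (fun z : E × F => (a * a') * (L z.1 * L' z.1) + (b * b') * (M z.2 * M' z.2))
      (μ.prod ν) := (i1.const_mul _).add (i2.const_mul _)
  have i6 : Integrable (fun z : E × F => (a * b') * (L z.1 * M' z.2) + (b * a') * (L' z.1 * M z.2))
      (μ.prod ν) := (i3.const_mul _).add (i4.const_mul _)
  rw [integral_add i5 i6,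
    integral_add (i1.const_mul _) (i2.const_mul _), integral_add (i3.const_mul _) (i4.const_mul _),
    integral_const_mul, integral_const_mul, integral_const_mul, integral_const_mul,
    integral_prod_mul (fun x => L x) (fun y => M' y), integral_prod_mul (fun x => L' x) (fun y => M y),
    hμ, hμ, integral_fun_fst (μ := μ) (ν := ν) (fun x => L x * L' x),
    integral_fun_snd (μ := μ) (ν := ν) (fun x => M x * M' x)]
  simp

/-- The `i`-th weight of the softmax of the family `c` at `x`. -/
def softmaxWeight {I : Type*} [Fintype I] (c : I → StrongDual ℝ E) (i : I) (x : E) : ℝ :=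
  Real.exp (c i x) / ∑ j, Real.exp (c j x)

variable {I : Type*} [Fintype I] [Nonempty I]

theorem sum_exp_pos (z : I → ℝ) : 0 < ∑ j, Real.exp (z j) :=
  Finset.sum_pos (fun _ _ => Real.exp_pos _) Finset.univ_nonempty

theorem softmaxWeight_nonneg (c : I → StrongDual ℝ E) (i : I) (x : E) :
    0 ≤ softmaxWeight c i x :=
  div_nonneg (Real.exp_pos _).le (sum_exp_pos _).le

theorem sum_softmaxWeight (c : I → StrongDual ℝ E) (x : E) :
    ∑ i, softmaxWeight c i x = 1 := by
  simp only [softmaxWeight, ← Finset.sum_div]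
  exact div_self (sum_exp_pos _).ne'

theorem softmaxWeight_le_one (c : I → StrongDual ℝ E) (i : I) (x : E) :
    softmaxWeight c i x ≤ 1 := by
  rw [← sum_softmaxWeight c x]
  exact Finset.single_le_sum (fun j _ => softmaxWeight_nonneg c j x) (Finset.mem_univ i)

theorem continuous_softmaxWeight (c : I → StrongDual ℝ E) (i : I) :
    Continuous (softmaxWeight c i) := by
  unfold softmaxWeight
  exact Continuous.div (by fun_prop) (by fun_prop) fun x => (sum_exp_pos _).ne'

theorem hasFDerivAt_softmaxWeight (c : I → StrongDual ℝ E) (i : I) (x : E) :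
    HasFDerivAt (softmaxWeight c i)
      (softmaxWeight c i x • (c i - ∑ j, softmaxWeight c j x • c j)) x := by
  have h1 : ∀ j, HasFDerivAt (fun x => Real.exp (c j x)) (Real.exp (c j x) • c j) x :=
    fun j => (c j).hasFDerivAt.exp
  have h2 : HasFDerivAt (fun x => ∑ j, Real.exp (c j x)) (∑ j, Real.exp (c j x) • c j) x :=
    HasFDerivAt.fun_sum fun j _ => h1 j
  have h3 := (h1 i).mul ((hasDerivAt_inv (sum_exp_pos fun j => c j x).ne').comp_hasFDerivAt x h2)
  convert! h3 using 1
  ext y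
  have hne := (sum_exp_pos fun j => c j x).ne'
  simp only [softmaxWeight, smul_apply, sub_apply,
    _root_.sum_apply, add_apply, smul_eq_mul, Function.comp_apply]
  have : ∑ j, Real.exp (c j x) / (∑ j, Real.exp (c j x)) * c j y =
      (∑ j, Real.exp (c j x) * c j y) / ∑ j, Real.exp (c j x) := by
    rw [Finset.sum_div]
    exact Finset.sum_congr rfl fun j _ => by ring
  rw [this]
  field_simp
  ring

/-- Gaussian integration by parts for softmax weights. -/
theorem integral_sum_softmaxWeight_mul {ρ : Measure E} [IsGaussian ρ]
    (h0 : ∀ L : StrongDual ℝ E, ρ[L] = 0) (c l : I → StrongDual ℝ E) :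
    ∫ x, ∑ i, softmaxWeight c i x * l i x ∂ρ =
      ∑ i, ∑ j, (∫ x, softmaxWeight c i x * softmaxWeight c j x ∂ρ) *
        ((∫ y, c i y * l i y ∂ρ) - ∫ y, c j y * l i y ∂ρ) := by
  have hint : ∀ i, Integrable (softmaxWeight c i) ρ := fun i =>
    integrable_of_polynomial_growth (continuous_softmaxWeight c i) 1 0 fun x => by
      rw [abs_of_nonneg (softmaxWeight_nonneg c i x)]
      simpa using softmaxWeight_le_one c i x
  have hint2 : ∀ i j, Integrable (fun x => softmaxWeight c i x * softmaxWeight c j x) ρ := fun i j =>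
    integrable_of_polynomial_growth
      ((continuous_softmaxWeight c i).mul (continuous_softmaxWeight c j)) 1 0 fun x => by
      rw [abs_of_nonneg (mul_nonneg (softmaxWeight_nonneg c i x) (softmaxWeight_nonneg c j x))]
      simpa using mul_le_one₀ (softmaxWeight_le_one c i x) (softmaxWeight_nonneg c j x)
        (softmaxWeight_le_one c j x)
  rw [integral_finsetSum]
  swap
  · intro i _
    refine integrable_of_polynomial_growth
      ((continuous_softmaxWeight c i).mul (l i).continuous) ‖l i‖ 1 fun x => ?_
    rw [abs_mul, abs_of_nonneg (softmaxWeight_nonneg c i x), pow_one]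
    have e := (l i).le_of_opNorm_le_of_le le_rfl (show ‖x‖ ≤ 1 + ‖x‖ by linarith)
    calc _ ≤ 1 * |l i x| := by gcongr; exact softmaxWeight_le_one c i x
      _ ≤ _ := by simpa using e
  refine Finset.sum_congr rfl fun i _ => ?_
  have hcont := continuous_softmaxWeight c
  have hsum : ∀ x, ‖∑ j, softmaxWeight c j x • c j‖ ≤ ∑ j, ‖c j‖ := fun x => by
    refine (norm_sum_le _ _).trans (Finset.sum_le_sum fun j _ => ?_)
    rw [norm_smul, Real.norm_of_nonneg (softmaxWeight_nonneg c j x)]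
    exact mul_le_of_le_one_left (norm_nonneg _) (softmaxWeight_le_one c j x)
  have hS : 0 ≤ ∑ j, ‖c j‖ := Finset.sum_nonneg fun _ _ => norm_nonneg _
  rw [gaussian_integration_by_parts h0 (l i) (hasFDerivAt_softmaxWeight c i)
    (by fun_prop) (C := 1 + ‖c i‖ + ∑ j, ‖c j‖) (fun x => by
      rw [abs_of_nonneg (softmaxWeight_nonneg c i x)]
      have := softmaxWeight_le_one c i x
      have := norm_nonneg (c i)
      linarith) (fun x => by
      rw [norm_smul, Real.norm_of_nonneg (softmaxWeight_nonneg c i x)]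
      refine (mul_le_of_le_one_left (norm_nonneg _) (softmaxWeight_le_one c i x)).trans ?_
      refine (norm_sub_le _ _).trans ?_
      linarith [hsum x])]
  have e : ∀ z : E × E, (softmaxWeight c i z.1 • (c i - ∑ j, softmaxWeight c j z.1 • c j)) z.2 *
      l i z.2 = ∑ j, (softmaxWeight c i z.1 * softmaxWeight c j z.1) *
        (c i z.2 * l i z.2 - c j z.2 * l i z.2) := by
    intro z
    simp only [smul_apply, sub_apply,
      sum_apply, smul_eq_mul, mul_sub, Finset.sum_sub_distrib]
    have h1 := sum_softmaxWeight c z.1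
    rw [← Finset.sum_mul, ← Finset.mul_sum, h1, sub_mul, Finset.mul_sum, Finset.sum_mul]
    congr 1
    · ring
    · exact Finset.sum_congr rfl fun j _ => by ring
  simp_rw [e]
  have hint3 : ∀ j, Integrable (fun y => c i y * l i y - c j y * l i y) ρ := fun j =>
    (integrable_dual_mul_dual ρ _ _).sub (integrable_dual_mul_dual ρ _ _)
  rw [integral_finsetSum _ fun j _ => (hint2 i j).mul_prod (hint3 j)]
  refine Finset.sum_congr rfl fun j _ => ?_
  rw [integral_prod_mul (fun x => softmaxWeight c i x * softmaxWeight c j x)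
    (fun y => c i y * l i y - c j y * l i y),
    integral_sub (integrable_dual_mul_dual ρ _ _) (integrable_dual_mul_dual ρ _ _)]

theorem abs_log_sum_exp_le (z : I → ℝ) :
    |Real.log (∑ i, Real.exp (z i))| ≤ Real.log (Fintype.card I) + ∑ i, |z i| := by
  have hle : ∀ i, |z i| ≤ ∑ i, |z i| := fun i =>
    Finset.single_le_sum (f := fun i => |z i|) (fun _ _ => abs_nonneg _) (Finset.mem_univ i)
  have hcard : (1 : ℝ) ≤ Fintype.card I := by exact_mod_cast Fintype.card_pos
  rw [abs_le]
  constructor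
  · obtain ⟨i⟩ := ‹Nonempty I›
    have h1 : Real.exp (z i) ≤ ∑ i, Real.exp (z i) :=
      Finset.single_le_sum (f := fun i => Real.exp (z i)) (fun _ _ => (Real.exp_pos _).le)
        (Finset.mem_univ i)
    have h2 := Real.log_le_log (Real.exp_pos _) h1
    rw [Real.log_exp] at h2
    have h3 := hle i
    have h4 := neg_abs_le (z i)
    have h5 := Real.log_nonneg hcard
    linarith
  · have h1 : ∑ i, Real.exp (z i) ≤ Fintype.card I * Real.exp (∑ i, |z i|) := by
      rw [← nsmul_eq_mul]
      exact Finset.sum_le_card_nsmul _ _ _ fun i _ =>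
        Real.exp_le_exp.2 ((le_abs_self _).trans (hle i))
    have h2 := Real.log_le_log (sum_exp_pos z) h1
    rwa [Real.log_mul (by positivity) (Real.exp_pos _).ne', Real.log_exp] at h2

theorem integrable_log_sum_exp {ρ : Measure E} [IsGaussian ρ] (c : I → StrongDual ℝ E) :
    Integrable (fun x => Real.log (∑ i, Real.exp (c i x))) ρ := by
  have hlog : 0 ≤ Real.log (Fintype.card I) :=
    Real.log_nonneg (by exact_mod_cast Fintype.card_pos)
  refine integrable_of_polynomial_growth
    (Continuous.log (by fun_prop) fun x => (sum_exp_pos _).ne')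
    (Real.log (Fintype.card I) + ∑ i, ‖c i‖) 1 fun x => ?_
  refine (abs_log_sum_exp_le fun i => c i x).trans ?_
  rw [pow_one, add_mul, Finset.sum_mul]
  gcongr with i
  · nlinarith [norm_nonneg x]
  · exact (c i).le_of_opNorm_le_of_le le_rfl (show ‖x‖ ≤ 1 + ‖x‖ by linarith)

/-- The Sudakov--Fernique comparison for the log-sum-exp function. -/
theorem integral_log_sum_exp_le {μ : Measure E} {ν : Measure F} [IsGaussian μ] [IsGaussian ν]
    (hμ : ∀ L : StrongDual ℝ E, μ[L] = 0) (hν : ∀ L : StrongDual ℝ F, ν[L] = 0)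
    (L : I → StrongDual ℝ E) (M : I → StrongDual ℝ F)
    (h : ∀ i j, ∫ x, (L i x - L j x) ^ 2 ∂μ ≤ ∫ y, (M i y - M j y) ^ 2 ∂ν) :
    ∫ x, Real.log (∑ i, Real.exp (L i x)) ∂μ ≤ ∫ y, Real.log (∑ i, Real.exp (M i y)) ∂ν := by
  set ρ := μ.prod ν with hρ
  have hρ0 : ∀ L : StrongDual ℝ (E × F), ρ[L] = 0 := integral_dual_prod_eq_zero hμ hν
  set c : ℝ → I → StrongDual ℝ (E × F) := fun θ i =>
    Real.cos θ • (L i).comp (ContinuousLinearMap.fst ℝ E F) +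
      Real.sin θ • (M i).comp (ContinuousLinearMap.snd ℝ E F) with hc
  set c' : ℝ → I → StrongDual ℝ (E × F) := fun θ i =>
    (-Real.sin θ) • (L i).comp (ContinuousLinearMap.fst ℝ E F) +
      Real.cos θ • (M i).comp (ContinuousLinearMap.snd ℝ E F) with hc'
  set φ : ℝ → ℝ := fun θ => ∫ w, Real.log (∑ i, Real.exp (c θ i w)) ∂ρ with hφ
  have hderiv : ∀ θ, HasDerivAt φ (∫ w, ∑ i, softmaxWeight (c θ) i w * c' θ i w ∂ρ) θ := by
    intro θ
    refine (hasDerivAt_integral_of_dominated_loc_of_deriv_le (μ := ρ)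
      (F := fun θ w => Real.log (∑ i, Real.exp (c θ i w)))
      (F' := fun θ w => ∑ i, softmaxWeight (c θ) i w * c' θ i w)
      (s := Set.univ) (bound := fun w => (∑ i, (‖L i‖ + ‖M i‖)) * (1 + ‖w‖) ^ 1)
      Filter.univ_mem (Filter.Eventually.of_forall fun θ => ?_) (integrable_log_sum_exp _) ?_
      (ae_of_all _ fun w θ _ => ?_) ((integrable_one_add_norm_pow _ 1).const_mul _)
      (ae_of_all _ fun w θ _ => ?_)).2
    · exact (integrable_log_sum_exp (ρ := ρ) (c θ)).aestronglyMeasurable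
    · refine Continuous.aestronglyMeasurable ?_
      have := continuous_softmaxWeight (c θ)
      fun_prop
    · refine (norm_sum_le _ _).trans ?_
      rw [Finset.sum_mul]
      refine Finset.sum_le_sum fun i _ => ?_
      rw [norm_mul, Real.norm_of_nonneg (softmaxWeight_nonneg _ i w)]
      refine (mul_le_of_le_one_left (norm_nonneg _) (softmaxWeight_le_one _ i w)).trans ?_
      simp only [hc', add_apply, smul_apply,
        ContinuousLinearMap.comp_apply, ContinuousLinearMap.coe_fst', ContinuousLinearMap.coe_snd',
        smul_eq_mul]
      refine (norm_add_le _ _).trans ?_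
      rw [norm_mul, norm_mul]
      have h1 := (L i).le_of_opNorm_le_of_le le_rfl (norm_fst_le w)
      have h2 := (M i).le_of_opNorm_le_of_le le_rfl (norm_snd_le w)
      have h3 : ‖-Real.sin θ‖ ≤ 1 := by simpa using Real.abs_sin_le_one θ
      have h4 : ‖Real.cos θ‖ ≤ 1 := by simpa using Real.abs_cos_le_one θ
      nlinarith [norm_nonneg (L i), norm_nonneg (M i), norm_nonneg w, norm_nonneg (L i w.1),
        norm_nonneg (M i w.2)]
    · have hci : ∀ i, HasDerivAt (fun θ => c θ i w) (c' θ i w) θ := fun i => by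
        simp only [hc, hc', add_apply, smul_apply,
          smul_eq_mul]
        exact ((Real.hasDerivAt_cos θ).mul_const _).add ((Real.hasDerivAt_sin θ).mul_const _)
      have hs : HasDerivAt (fun θ => ∑ i, Real.exp (c θ i w))
          (∑ i, Real.exp (c θ i w) * c' θ i w) θ :=
        HasDerivAt.fun_sum fun i _ => (hci i).exp
      convert! hs.log (sum_exp_pos _).ne' using 1
      rw [Finset.sum_div]
      exact Finset.sum_congr rfl fun i _ => by rw [softmaxWeight]; ring
  have hnonneg : ∀ θ ∈ Set.Icc 0 (Real.pi / 2),
      0 ≤ ∫ w, ∑ i, softmaxWeight (c θ) i w * c' θ i w ∂ρ := by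
    intro θ hθ
    have hs : 0 ≤ Real.sin θ :=
      Real.sin_nonneg_of_nonneg_of_le_pi hθ.1 (by linarith [hθ.2, Real.pi_pos])
    have hco : 0 ≤ Real.cos θ :=
      Real.cos_nonneg_of_mem_Icc ⟨by linarith [hθ.1, Real.pi_pos], hθ.2⟩
    rw [integral_sum_softmaxWeight_mul hρ0]
    have hK : ∀ i j, ∫ y, c θ j y * c' θ i y ∂ρ = Real.sin θ * Real.cos θ *
        ((∫ y, M j y * M i y ∂ν) - ∫ x, L j x * L i x ∂μ) := by
      intro i j
      have := integral_prod_mul_combination (ν := ν) hμ (L j) (L i) (M j) (M i)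
        (Real.cos θ) (Real.sin θ) (-Real.sin θ) (Real.cos θ)
      simp only [hc, hc', add_apply, smul_apply,
        ContinuousLinearMap.comp_apply, ContinuousLinearMap.coe_fst', ContinuousLinearMap.coe_snd',
        smul_eq_mul]
      rw [this]
      ring
    simp_rw [hK]
    set π : I → I → ℝ := fun i j => ∫ x, softmaxWeight (c θ) i x * softmaxWeight (c θ) j x ∂ρ
      with hπ
    have hπ0 : ∀ i j, 0 ≤ π i j := fun i j => integral_nonneg fun x =>
      mul_nonneg (softmaxWeight_nonneg _ i x) (softmaxWeight_nonneg _ j x)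
    have hπs : ∀ i j, π i j = π j i := fun i j => by simp only [hπ, mul_comm]
    set K : I → I → ℝ := fun j i => Real.sin θ * Real.cos θ *
        ((∫ y, M j y * M i y ∂ν) - ∫ x, L j x * L i x ∂μ) with hKdef
    change 0 ≤ ∑ i, ∑ j, π i j * (K i i - K j i)
    have hsym : ∑ i, ∑ j, π i j * (K i i - K j i) =
        ∑ i, ∑ j, π i j * (K j j - K i j) := by
      rw [Finset.sum_comm]
      exact Finset.sum_congr rfl fun i _ => Finset.sum_congr rfl fun j _ => by rw [hπs]
    have hinc : ∀ i j, 0 ≤ (K i i - K j i) + (K j j - K i j) := by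
      intro i j
      have h1 := h i j
      rw [integral_dual_sub_sq μ, integral_dual_sub_sq ν] at h1
      have h2 : (K i i - K j i) + (K j j - K i j) = Real.sin θ * Real.cos θ *
          (((∫ y, M i y * M i y ∂ν) + (∫ y, M j y * M j y ∂ν) - 2 * ∫ y, M i y * M j y ∂ν) -
            ((∫ y, L i y * L i y ∂μ) + (∫ y, L j y * L j y ∂μ) - 2 * ∫ y, L i y * L j y ∂μ)) := by
        simp only [hKdef, mul_comm (M j _) (M i _), mul_comm (L j _) (L i _)]; ring
      rw [h2]
      exact mul_nonneg (mul_nonneg hs hco) (by linarith)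
    have : 0 ≤ ∑ i, ∑ j, π i j * ((K i i - K j i) + (K j j - K i j)) :=
      Finset.sum_nonneg fun i _ => Finset.sum_nonneg fun j _ => mul_nonneg (hπ0 i j) (hinc i j)
    simp_rw [mul_add, Finset.sum_add_distrib] at this
    linarith
  have hmono : MonotoneOn φ (Set.Icc 0 (Real.pi / 2)) :=
    monotoneOn_of_deriv_nonneg (convex_Icc _ _)
      (fun θ _ => (hderiv θ).continuousAt.continuousWithinAt)
      (fun θ _ => (hderiv θ).differentiableAt.differentiableWithinAt)
      (fun θ hθ => by
        rw [(hderiv θ).deriv]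
        exact hnonneg θ (interior_subset hθ))
  have hpi : 0 ≤ Real.pi / 2 := by positivity
  have hle := hmono (Set.left_mem_Icc.2 hpi) (Set.right_mem_Icc.2 hpi) hpi
  have e0 : φ 0 = ∫ x, Real.log (∑ i, Real.exp (L i x)) ∂μ := by
    simp only [hφ, hc, Real.cos_zero, Real.sin_zero, one_smul, zero_smul, add_zero,
      ContinuousLinearMap.comp_apply, ContinuousLinearMap.coe_fst']
    rw [hρ, integral_fun_fst (μ := μ) (ν := ν) (fun x => Real.log (∑ i, Real.exp (L i x)))]
    simp
  have e1 : φ (Real.pi / 2) = ∫ y, Real.log (∑ i, Real.exp (M i y)) ∂ν := by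
    simp only [hφ, hc, Real.cos_pi_div_two, Real.sin_pi_div_two, one_smul, zero_smul, zero_add,
      ContinuousLinearMap.comp_apply, ContinuousLinearMap.coe_snd']
    rw [hρ, integral_fun_snd (μ := μ) (ν := ν) (fun x => Real.log (∑ i, Real.exp (M i x)))]
    simp
  rwa [e0, e1] at hle

theorem sup_le_log_sum_exp (z : I → ℝ) :
    Finset.univ.sup' Finset.univ_nonempty z ≤ Real.log (∑ i, Real.exp (z i)) := by
  refine Finset.sup'_le _ _ fun i _ => ?_
  rw [Real.le_log_iff_exp_le (sum_exp_pos z)]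
  exact Finset.single_le_sum (f := fun i => Real.exp (z i)) (fun _ _ => (Real.exp_pos _).le)
    (Finset.mem_univ i)

theorem log_sum_exp_le_sup_add (z : I → ℝ) :
    Real.log (∑ i, Real.exp (z i)) ≤
      Finset.univ.sup' Finset.univ_nonempty z + Real.log (Fintype.card I) := by
  have hcard : (0 : ℝ) < Fintype.card I := by exact_mod_cast Fintype.card_pos
  have h1 : ∑ i, Real.exp (z i) ≤
      Fintype.card I * Real.exp (Finset.univ.sup' Finset.univ_nonempty z) := by
    rw [← nsmul_eq_mul]
    exact Finset.sum_le_card_nsmul _ _ _ fun i hi => Real.exp_le_exp.2 (Finset.le_sup' z hi)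
  have h2 := Real.log_le_log (sum_exp_pos z) h1
  rw [Real.log_mul hcard.ne' (Real.exp_pos _).ne', Real.log_exp] at h2
  linarith

theorem abs_sup_le_sum_abs (z : I → ℝ) :
    |Finset.univ.sup' Finset.univ_nonempty z| ≤ ∑ i, |z i| := by
  obtain ⟨i, -, hi⟩ := Finset.exists_mem_eq_sup' Finset.univ_nonempty z
  rw [hi]
  exact Finset.single_le_sum (f := fun i => |z i|) (fun _ _ => abs_nonneg _) (Finset.mem_univ i)

theorem integrable_sup_dual {ρ : Measure E} [IsGaussian ρ] (c : I → StrongDual ℝ E) :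
    Integrable (fun x => Finset.univ.sup' Finset.univ_nonempty fun i => c i x) ρ := by
  refine integrable_of_polynomial_growth
    (Continuous.finset_sup'_apply Finset.univ_nonempty fun i _ => (c i).continuous)
    (∑ i, ‖c i‖) 1 fun x => (abs_sup_le_sum_abs fun i => c i x).trans ?_
  rw [pow_one, Finset.sum_mul]
  gcongr with i
  exact (c i).le_of_opNorm_le_of_le le_rfl (show ‖x‖ ≤ 1 + ‖x‖ by linarith)

/-- The Sudakov--Fernique inequality for finite families. -/
theorem integral_sup_le_of_increments_le {μ : Measure E} {ν : Measure F} [IsGaussian μ]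
    [IsGaussian ν] (hμ : ∀ L : StrongDual ℝ E, μ[L] = 0) (hν : ∀ L : StrongDual ℝ F, ν[L] = 0)
    (L : I → StrongDual ℝ E) (M : I → StrongDual ℝ F)
    (h : ∀ i j, ∫ x, (L i x - L j x) ^ 2 ∂μ ≤ ∫ y, (M i y - M j y) ^ 2 ∂ν) :
    ∫ x, Finset.univ.sup' Finset.univ_nonempty (fun i => L i x) ∂μ ≤
      ∫ y, Finset.univ.sup' Finset.univ_nonempty (fun i => M i y) ∂ν := by
  set a := ∫ x, Finset.univ.sup' Finset.univ_nonempty (fun i => L i x) ∂μ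
  set b := ∫ y, Finset.univ.sup' Finset.univ_nonempty (fun i => M i y) ∂ν
  have hcard : 0 ≤ Real.log (Fintype.card I) :=
    Real.log_nonneg (by exact_mod_cast Fintype.card_pos)
  have hscale : ∀ (β : ℝ), 0 < β → ∀ z : I → ℝ,
      Finset.univ.sup' Finset.univ_nonempty (fun i => β * z i) =
        β * Finset.univ.sup' Finset.univ_nonempty z := fun β hβ z => by
    refine le_antisymm (Finset.sup'_le _ _ fun i hi => ?_) ?_
    · exact mul_le_mul_of_nonneg_left (Finset.le_sup' z hi) hβ.le
    · obtain ⟨i, hi, h⟩ := Finset.exists_mem_eq_sup' Finset.univ_nonempty z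
      rw [h]
      exact Finset.le_sup' (fun i => β * z i) hi
  have key : ∀ β : ℝ, 0 < β → β * a ≤ β * b + Real.log (Fintype.card I) := by
    intro β hβ
    have h1 := integral_log_sum_exp_le hμ hν (fun i => β • L i) (fun i => β • M i) fun i j => by
      have e : ∀ p q : ℝ, (β * p - β * q) ^ 2 = β ^ 2 * (p - q) ^ 2 := fun p q => by ring
      simp only [smul_apply, smul_eq_mul, e, integral_const_mul]
      exact mul_le_mul_of_nonneg_left (h i j) (by positivity)
    have h2 : β * a ≤ ∫ x, Real.log (∑ i, Real.exp ((β • L i) x)) ∂μ := by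
      rw [← integral_const_mul]
      refine integral_mono ((integrable_sup_dual L).const_mul _) (integrable_log_sum_exp _) fun x => ?_
      simp only
      rw [← hscale β hβ]
      exact sup_le_log_sum_exp fun i => (β • L i) x
    have h3 : ∫ x, Real.log (∑ i, Real.exp ((β • M i) x)) ∂ν ≤
        β * b + Real.log (Fintype.card I) := by
      have e : β * b + Real.log (Fintype.card I) = ∫ y,
          (β * (Finset.univ.sup' Finset.univ_nonempty fun i => M i y) +
            Real.log (Fintype.card I)) ∂ν := by
        rw [integral_add ((integrable_sup_dual M).const_mul _) (integrable_const _),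
          integral_const_mul]
        simp [b]
      rw [e]
      refine integral_mono (integrable_log_sum_exp _)
        (((integrable_sup_dual M).const_mul _).add (integrable_const _)) fun x => ?_
      simp only
      rw [← hscale β hβ]
      exact log_sum_exp_le_sup_add fun i => (β • M i) x
    linarith
  by_contra! hlt
  have hd : 0 < a - b := by linarith
  have h1 := key ((Real.log (Fintype.card I) + 1) / (a - b)) (by positivity)
  have h2 : (Real.log (Fintype.card I) + 1) / (a - b) * (a - b) =
      Real.log (Fintype.card I) + 1 := div_mul_cancel₀ _ hd.ne'
  linarith

end SudakovFernique

theorem integral_mul_sq_le {X : Type*} [MeasurableSpace X] {ρ : Measure X} {f g : X → ℝ}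
    (hf : Integrable (fun x => f x ^ 2) ρ) (hg : Integrable (fun x => g x ^ 2) ρ)
    (hfg : Integrable (fun x => f x * g x) ρ) :
    (∫ x, f x * g x ∂ρ) ^ 2 ≤ (∫ x, f x ^ 2 ∂ρ) * ∫ x, g x ^ 2 ∂ρ := by
  have h : ∀ a : ℝ, 0 ≤ (∫ x, g x ^ 2 ∂ρ) * (a * a) + (2 * ∫ x, f x * g x ∂ρ) * a +
      ∫ x, f x ^ 2 ∂ρ := fun a => by
    have h0 : 0 ≤ ∫ x, (f x + a * g x) ^ 2 ∂ρ := integral_nonneg fun x => sq_nonneg _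
    have e : ∀ x, (f x + a * g x) ^ 2 = (a * a * g x ^ 2 + 2 * a * (f x * g x)) + f x ^ 2 :=
      fun x => by ring
    have i1 : Integrable (fun x => a * a * g x ^ 2 + 2 * a * (f x * g x)) ρ :=
      (hg.const_mul _).add (hfg.const_mul _)
    simp_rw [e] at h0
    rw [integral_add i1 hf, integral_add (hg.const_mul _) (hfg.const_mul _),
      integral_const_mul, integral_const_mul] at h0
    linarith
  have := discrim_le_zero h
  rw [discrim] at this
  linarith

section Comparison

variable {ι V : Type*} [Fintype ι] [NormedAddCommGroup V] [InnerProductSpace ℝ V]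
  [CompleteSpace V] [SecondCountableTopology V] [MeasurableSpace V] [BorelSpace V]

theorem integral_stdGaussian_inner_mul_inner (q q' : EuclideanSpace ℝ ι) :
    ∫ y, ⟪q, y⟫ * ⟪q', y⟫ ∂(stdGaussian (EuclideanSpace ℝ ι)) = ⟪q, q'⟫ := by
  have h := covarianceBilin_apply (μ := stdGaussian (EuclideanSpace ℝ ι))
    IsGaussian.memLp_two_id q q'
  simp only [covarianceBilin_stdGaussian, id_eq, integral_id_stdGaussian] at h
  have e : innerSL ℝ q q' = ⟪q, q'⟫ := rfl
  rw [← e, h]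
  simp

theorem integral_linear_sub_sq {E : Type*} [NormedAddCommGroup E] [NormedSpace ℝ E]
    [MeasurableSpace E] [BorelSpace E] [SecondCountableTopology E] [CompleteSpace E]
    (ρ : Measure E) [IsGaussian ρ] (L L' : StrongDual ℝ E) (a b : ℝ) :
    ∫ x, (a * L x - b * L' x) ^ 2 ∂ρ = a ^ 2 * (∫ x, L x * L x ∂ρ) +
      b ^ 2 * (∫ x, L' x * L' x ∂ρ) - 2 * (a * b) * ∫ x, L x * L' x ∂ρ := by
  have h := integral_dual_sub_sq ρ (a • L) (b • L')
  simp only [smul_apply, smul_eq_mul, mul_mul_mul_comm, integral_const_mul] at h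
  rw [h]
  ring

/-- A Chevet type comparison: the bilinear process `∑ t, q t * ⟪w, A t⟫` is dominated by a
sum of two independent linear processes. -/
theorem integral_sup_bilinear_le {μ : Measure (ι → V)} {ν : Measure V} [IsGaussian μ]
    [IsGaussian ν] (hμ : ∀ L : StrongDual ℝ (ι → V), μ[L] = 0)
    (hν : ∀ L : StrongDual ℝ V, ν[L] = 0)
    (hdom : ∀ c : ι → V, ∫ A, (∑ t, ⟪c t, A t⟫) ^ 2 ∂μ ≤ ∑ t, ∫ k, ⟪c t, k⟫ ^ 2 ∂ν)
    {J : Type*} [Fintype J] [Nonempty J] (w : J → V) (q : J → EuclideanSpace ℝ ι) :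
    ∫ A, Finset.univ.sup' Finset.univ_nonempty (fun j => ∑ t, q j t * ⟪w j, A t⟫) ∂μ ≤
      ∫ z, Finset.univ.sup' Finset.univ_nonempty (fun j =>
        √(∫ k, ⟪w j, k⟫ ^ 2 ∂ν) * ⟪q j, z.1⟫ + ‖q j‖ * ⟪w j, z.2⟫)
        ∂((stdGaussian (EuclideanSpace ℝ ι)).prod ν) := by
  set P : J → ℝ := fun j => √(∫ k, ⟪w j, k⟫ ^ 2 ∂ν) with hP
  have hP0 : ∀ j, 0 ≤ P j := fun j => Real.sqrt_nonneg _
  have hPsq : ∀ j, ∫ k, ⟪w j, k⟫ * ⟪w j, k⟫ ∂ν = P j ^ 2 := fun j => by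
    simp_rw [← sq]
    rw [hP, Real.sq_sqrt (integral_nonneg fun _ => sq_nonneg _)]
  have hγ := integral_strongDual_stdGaussian (E := EuclideanSpace ℝ ι)
  have key := integral_sup_le_of_increments_le (I := J) hμ (integral_dual_prod_eq_zero hγ hν)
    (fun j => ∑ t, q j t • (innerSL ℝ (w j)).comp (ContinuousLinearMap.proj t))
    (fun j => P j • (innerSL ℝ (q j)).comp (ContinuousLinearMap.fst ℝ _ V) +
      ‖q j‖ • (innerSL ℝ (w j)).comp (ContinuousLinearMap.snd ℝ (EuclideanSpace ℝ ι) V)) ?_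
  · simpa using key
  intro i j
  set r := ∫ k, ⟪w i, k⟫ * ⟪w j, k⟫ ∂ν with hr
  have hrle : r ≤ P i * P j := by
    refine le_of_sq_le_sq ?_ (mul_nonneg (hP0 i) (hP0 j))
    have := integral_mul_sq_le (ρ := ν) (f := fun k => ⟪w i, k⟫) (g := fun k => ⟪w j, k⟫)
      (by simpa [sq] using integrable_dual_mul_dual ν (innerSL ℝ (w i)) (innerSL ℝ (w i)))
      (by simpa [sq] using integrable_dual_mul_dual ν (innerSL ℝ (w j)) (innerSL ℝ (w j)))
      (by simpa using integrable_dual_mul_dual ν (innerSL ℝ (w i)) (innerSL ℝ (w j)))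
    simp_rw [sq (inner ℝ _ _), hPsq] at this
    rw [mul_pow]
    exact this
  have hν2 : ∀ a b : ℝ, ∫ k, ⟪a • w i - b • w j, k⟫ ^ 2 ∂ν =
      a ^ 2 * P i ^ 2 + b ^ 2 * P j ^ 2 - 2 * (a * b) * r := fun a b => by
    have := integral_linear_sub_sq ν (innerSL ℝ (w i)) (innerSL ℝ (w j)) a b
    simp only [innerSL_apply_apply, hPsq] at this
    simp_rw [inner_sub_left, real_inner_smul_left]
    exact this
  have hL : ∫ A, (∑ t, q i t * ⟪w i, A t⟫ - ∑ t, q j t * ⟪w j, A t⟫) ^ 2 ∂μ ≤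
      ‖q i‖ ^ 2 * P i ^ 2 + ‖q j‖ ^ 2 * P j ^ 2 - 2 * ⟪q i, q j⟫ * r := by
    have h := hdom fun t => q i t • w i - q j t • w j
    simp_rw [hν2] at h
    simp_rw [inner_sub_left, real_inner_smul_left, Finset.sum_sub_distrib] at h
    refine h.trans (le_of_eq ?_)
    rw [Finset.sum_add_distrib, ← Finset.sum_mul, ← Finset.sum_mul, ← Finset.sum_mul,
      ← Finset.mul_sum]
    simp [EuclideanSpace.norm_sq_eq, PiLp.inner_apply, mul_comm]
  have hM : ∫ z : EuclideanSpace ℝ ι × V, ((P i * ⟪q i, z.1⟫ + ‖q i‖ * ⟪w i, z.2⟫) -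
      (P j * ⟪q j, z.1⟫ + ‖q j‖ * ⟪w j, z.2⟫)) ^ 2
      ∂((stdGaussian (EuclideanSpace ℝ ι)).prod ν) =
      (P i ^ 2 * ‖q i‖ ^ 2 + P j ^ 2 * ‖q j‖ ^ 2 - 2 * (P i * P j) * ⟪q i, q j⟫) +
      (‖q i‖ ^ 2 * P i ^ 2 + ‖q j‖ ^ 2 * P j ^ 2 - 2 * (‖q i‖ * ‖q j‖) * r) := by
    have h := integral_prod_mul_combination (ν := ν) hγ
      (P i • innerSL ℝ (q i) - P j • innerSL ℝ (q j)) (P i • innerSL ℝ (q i) - P j • innerSL ℝ (q j))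
      (‖q i‖ • innerSL ℝ (w i) - ‖q j‖ • innerSL ℝ (w j))
      (‖q i‖ • innerSL ℝ (w i) - ‖q j‖ • innerSL ℝ (w j)) 1 1 1 1
    have h1 := integral_linear_sub_sq (stdGaussian (EuclideanSpace ℝ ι)) (innerSL ℝ (q i))
      (innerSL ℝ (q j)) (P i) (P j)
    have h2 := integral_linear_sub_sq ν (innerSL ℝ (w i)) (innerSL ℝ (w j)) ‖q i‖ ‖q j‖
    simp only [innerSL_apply_apply, hPsq, integral_stdGaussian_inner_mul_inner,
      real_inner_self_eq_norm_sq] at h1 h2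
    rw [← h1, ← h2]
    simp only [sub_apply, smul_apply, smul_eq_mul, innerSL_apply_apply, one_mul, ← sq, one_pow] at h
    rw [← h]
    congr 1
    ext z
    ring
  have hc : ⟪q i, q j⟫ ≤ ‖q i‖ * ‖q j‖ := real_inner_le_norm _ _
  have hfin : ‖q i‖ ^ 2 * P i ^ 2 + ‖q j‖ ^ 2 * P j ^ 2 - 2 * ⟪q i, q j⟫ * r ≤
      (P i ^ 2 * ‖q i‖ ^ 2 + P j ^ 2 * ‖q j‖ ^ 2 - 2 * (P i * P j) * ⟪q i, q j⟫) +
      (‖q i‖ ^ 2 * P i ^ 2 + ‖q j‖ ^ 2 * P j ^ 2 - 2 * (‖q i‖ * ‖q j‖) * r) := by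
    nlinarith [mul_nonneg (sub_nonneg.2 hc) (sub_nonneg.2 hrle),
      sq_nonneg (P i * ‖q i‖ - P j * ‖q j‖)]
  have := (hL.trans hfin).trans hM.ge
  simpa using this

end Comparison

section PolynomialGrowth

/-- Continuous functions of at most polynomial growth. -/
structure PolyGrowth {E W : Type*} [NormedAddCommGroup E] [NormedAddCommGroup W] (f : E → W) :
    Prop where
  continuous : Continuous f
  bound : ∃ (C : ℝ) (k : ℕ), ∀ x, ‖f x‖ ≤ C * (1 + ‖x‖) ^ k

namespace PolyGrowth

variable {E W : Type*} [NormedAddCommGroup E] [NormedAddCommGroup W]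

theorem integrable [NormedSpace ℝ E] [MeasurableSpace E] [BorelSpace E]
    [SecondCountableTopology E] [CompleteSpace E] {f : E → ℝ} (hf : PolyGrowth f)
    (ρ : Measure E) [IsGaussian ρ] : Integrable f ρ := by
  obtain ⟨C, k, h⟩ := hf.bound
  exact integrable_of_polynomial_growth hf.continuous C k h

theorem mono {W' : Type*} [NormedAddCommGroup W'] {f : E → W} {g : E → W'} (hf : Continuous f)
    (hg : PolyGrowth g) (h : ∀ x, ‖f x‖ ≤ ‖g x‖) : PolyGrowth f := by
  obtain ⟨C, k, hC⟩ := hg.bound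
  exact ⟨hf, C, k, fun x => (h x).trans (hC x)⟩

theorem const (c : W) : PolyGrowth fun _ : E => c :=
  ⟨continuous_const, ‖c‖, 0, fun x => by simp⟩

theorem of_clm [NormedSpace ℝ E] [NormedSpace ℝ W] (L : E →L[ℝ] W) : PolyGrowth fun x => L x :=
  ⟨L.continuous, ‖L‖, 1, fun x => by
    rw [pow_one]
    exact L.le_of_opNorm_le_of_le le_rfl (show ‖x‖ ≤ 1 + ‖x‖ by linarith)⟩

theorem of_bound_mul {W₁ W₂ : Type*} [NormedAddCommGroup W₁] [NormedAddCommGroup W₂] {f : E → W}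
    {g : E → W₁} {h : E → W₂} (hf : Continuous f) (hg : PolyGrowth g) (hh : PolyGrowth h)
    (H : ∀ x, ‖f x‖ ≤ ‖g x‖ * ‖h x‖) : PolyGrowth f := by
  obtain ⟨C, k, hC⟩ := hg.bound
  obtain ⟨C', k', hC'⟩ := hh.bound
  refine ⟨hf, C * C', k + k', fun x => (H x).trans ?_⟩
  rw [pow_add, mul_mul_mul_comm]
  exact mul_le_mul (hC x) (hC' x) (norm_nonneg _) ((norm_nonneg _).trans (hC x))

theorem mul {f g : E → ℝ} (hf : PolyGrowth f) (hg : PolyGrowth g) :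
    PolyGrowth fun x => f x * g x :=
  of_bound_mul (hf.continuous.mul hg.continuous) hf hg fun _ => norm_mul_le _ _

theorem inner [InnerProductSpace ℝ W] {f g : E → W} (hf : PolyGrowth f) (hg : PolyGrowth g) :
    PolyGrowth fun x => ⟪f x, g x⟫ :=
  of_bound_mul (hf.continuous.inner hg.continuous) hf hg fun _ => norm_inner_le_norm _ _

theorem smul [NormedSpace ℝ W] {f : E → ℝ} {g : E → W} (hf : PolyGrowth f) (hg : PolyGrowth g) :
    PolyGrowth fun x => f x • g x :=
  of_bound_mul (hf.continuous.smul hg.continuous) hf hg fun _ => norm_smul_le _ _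

theorem add {f g : E → W} (hf : PolyGrowth f) (hg : PolyGrowth g) :
    PolyGrowth fun x => f x + g x := by
  obtain ⟨C, k, hC⟩ := hf.bound
  obtain ⟨C', k', hC'⟩ := hg.bound
  have h0 : 0 ≤ C := by simpa using (norm_nonneg _).trans (hC 0)
  have h0' : 0 ≤ C' := by simpa using (norm_nonneg _).trans (hC' 0)
  refine ⟨hf.continuous.add hg.continuous, C + C', k + k', fun x => (norm_add_le _ _).trans ?_⟩
  rw [add_mul]
  have h1 : 1 ≤ 1 + ‖x‖ := by linarith [norm_nonneg x]
  exact add_le_add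
    ((hC x).trans (mul_le_mul_of_nonneg_left (pow_le_pow_right₀ h1 (by omega)) h0))
    ((hC' x).trans (mul_le_mul_of_nonneg_left (pow_le_pow_right₀ h1 (by omega)) h0'))

theorem norm {f : E → W} (hf : PolyGrowth f) : PolyGrowth fun x => ‖f x‖ :=
  mono hf.continuous.norm hf fun x => by simp

theorem abs {f : E → ℝ} (hf : PolyGrowth f) : PolyGrowth fun x => |f x| := hf.norm

theorem neg {f : E → W} (hf : PolyGrowth f) : PolyGrowth fun x => -f x :=
  mono hf.continuous.neg hf fun x => by simp

theorem sub {f g : E → W} (hf : PolyGrowth f) (hg : PolyGrowth g) :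
    PolyGrowth fun x => f x - g x := by
  simpa [sub_eq_add_neg] using hf.add hg.neg

theorem sq {f : E → ℝ} (hf : PolyGrowth f) : PolyGrowth fun x => f x ^ 2 := by
  simpa [_root_.sq] using hf.mul hf

theorem sqrt {f : E → ℝ} (hf : PolyGrowth f) : PolyGrowth fun x => √(f x) := by
  refine mono hf.continuous.sqrt ((const (1 : ℝ)).add hf.abs) fun x => ?_
  rw [Real.norm_of_nonneg (Real.sqrt_nonneg _), Real.norm_of_nonneg (by positivity)]
  refine Real.sqrt_le_iff.2 ⟨by positivity, ?_⟩
  nlinarith [le_abs_self (f x), abs_nonneg (f x)]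

theorem sum {ι : Type*} (s : Finset ι) {f : ι → E → W} (hf : ∀ i, PolyGrowth (f i)) :
    PolyGrowth fun x => ∑ i ∈ s, f i x := by
  classical
  induction s using Finset.induction_on with
  | empty => simpa using const (0 : W)
  | insert a s ha ih => simpa [Finset.sum_insert ha] using (hf a).add ih

theorem sup {I : Type*} [Fintype I] [Nonempty I] {f : I → E → ℝ} (hf : ∀ i, PolyGrowth (f i)) :
    PolyGrowth fun x => Finset.univ.sup' Finset.univ_nonempty fun i => f i x := by
  refine mono (Continuous.finset_sup'_apply Finset.univ_nonempty fun i _ => (hf i).continuous)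
    (sum Finset.univ fun i => (hf i).abs) fun x => ?_
  rw [Real.norm_eq_abs, Real.norm_of_nonneg (Finset.sum_nonneg fun _ _ => abs_nonneg _)]
  exact abs_sup_le_sum_abs fun i => f i x

end PolyGrowth

end PolynomialGrowth

section Decoupling

variable {ι V : Type*} [Fintype ι] [NormedAddCommGroup V] [InnerProductSpace ℝ V]
  [CompleteSpace V] [SecondCountableTopology V] [MeasurableSpace V] [BorelSpace V]

variable {I : Type*} [Fintype I] [Nonempty I]

theorem polyGrowth_eval (t : ι) : PolyGrowth fun A : ι → V => A t :=
  .of_clm (ContinuousLinearMap.proj t : (ι → V) →L[ℝ] V)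

theorem polyGrowth_eval_fst {W : Type*} [NormedAddCommGroup W] [NormedSpace ℝ W] (t : ι) :
    PolyGrowth fun z : (ι → V) × W => z.1 t :=
  .of_clm ((ContinuousLinearMap.proj t : (ι → V) →L[ℝ] V).comp
    (ContinuousLinearMap.fst ℝ (ι → V) W))

theorem polyGrowth_eval_snd {W : Type*} [NormedAddCommGroup W] [NormedSpace ℝ W] (t : ι) :
    PolyGrowth fun z : W × (ι → V) => z.2 t :=
  .of_clm ((ContinuousLinearMap.proj t : (ι → V) →L[ℝ] V).comp
    (ContinuousLinearMap.snd ℝ W (ι → V)))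

/-- Decoupling of a centered quadratic chaos. -/
theorem integral_sup_abs_quadratic_sub_le {μ : Measure (ι → V)} [IsGaussian μ]
    (hμ : ∀ L : StrongDual ℝ (ι → V), μ[L] = 0) (u : I → V) :
    ∫ A, Finset.univ.sup' Finset.univ_nonempty (fun i =>
        |∑ t, ⟪u i, A t⟫ ^ 2 - ∫ A, ∑ t, ⟪u i, A t⟫ ^ 2 ∂μ|) ∂μ ≤
      2 * ∫ z : (ι → V) × (ι → V), Finset.univ.sup' Finset.univ_nonempty (fun i =>
        |∑ t, ⟪u i, z.1 t⟫ * ⟪u i, z.2 t⟫|) ∂(μ.prod μ) := by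
  have hβ : ∀ i, PolyGrowth fun A : ι → V => ∑ t, ⟪u i, A t⟫ ^ 2 := fun i =>
    .sum _ fun t => ((PolyGrowth.const (u i)).inner (polyGrowth_eval t)).sq
  have hF : PolyGrowth fun z : (ι → V) × (ι → V) => Finset.univ.sup' Finset.univ_nonempty
      fun i => |∑ t, ⟪u i, z.1 t⟫ ^ 2 - ∑ t, ⟪u i, z.2 t⟫ ^ 2| :=
    .sup fun i => (PolyGrowth.sub
      (.sum _ fun t => ((PolyGrowth.const (u i)).inner (polyGrowth_eval_fst t)).sq)
      (.sum _ fun t => ((PolyGrowth.const (u i)).inner (polyGrowth_eval_snd t)).sq)).abs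
  calc _ ≤ ∫ A, ∫ B, Finset.univ.sup' Finset.univ_nonempty
        (fun i => |∑ t, ⟪u i, A t⟫ ^ 2 - ∑ t, ⟪u i, B t⟫ ^ 2|) ∂μ ∂μ := by
        refine integral_mono ((PolyGrowth.sup fun i => ((hβ i).sub (.const _)).abs).integrable μ)
          (hF.integrable (μ.prod μ)).integral_prod_left fun A => ?_
        have hG : PolyGrowth fun B : ι → V => Finset.univ.sup' Finset.univ_nonempty
            (fun i => |∑ t, ⟪u i, A t⟫ ^ 2 - ∑ t, ⟪u i, B t⟫ ^ 2|) :=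
          .sup fun i => ((PolyGrowth.const _).sub (hβ i)).abs
        refine Finset.sup'_le _ _ fun i hi => ?_
        have e : ∑ t, ⟪u i, A t⟫ ^ 2 - ∫ A, ∑ t, ⟪u i, A t⟫ ^ 2 ∂μ =
            ∫ B, (∑ t, ⟪u i, A t⟫ ^ 2 - ∑ t, ⟪u i, B t⟫ ^ 2) ∂μ := by
          rw [integral_sub (integrable_const _) ((hβ i).integrable μ)]
          simp
        rw [e]
        refine abs_integral_le_integral_abs.trans (integral_mono
          (((PolyGrowth.const _).sub (hβ i)).abs.integrable μ) (hG.integrable μ) fun B => ?_)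
        exact Finset.le_sup' (fun i => |∑ t, ⟪u i, A t⟫ ^ 2 - ∑ t, ⟪u i, B t⟫ ^ 2|) hi
    _ = ∫ z : (ι → V) × (ι → V), Finset.univ.sup' Finset.univ_nonempty
        (fun i => |∑ t, ⟪u i, z.1 t⟫ ^ 2 - ∑ t, ⟪u i, z.2 t⟫ ^ 2|) ∂(μ.prod μ) :=
        (integral_prod _ (hF.integrable (μ.prod μ))).symm
    _ = ∫ z : (ι → V) × (ι → V), 2 * Finset.univ.sup' Finset.univ_nonempty (fun i =>
        |∑ t, ⟪u i, z.1 t⟫ * ⟪u i, z.2 t⟫|) ∂(μ.prod μ) := by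
        rw [← IsGaussian.map_rotation_eq_self_of_forall_strongDual_eq_zero hμ (Real.pi / 4),
          integral_map (ContinuousLinearMap.continuous _).aemeasurable
            hF.continuous.aestronglyMeasurable,
          IsGaussian.map_rotation_eq_self_of_forall_strongDual_eq_zero hμ]
        congr 1
        ext z
        rw [Finset.mul₀_sup' (zero_le_two : (0 : ℝ) ≤ 2)]
        congr 1
        ext i
        rw [← abs_two, ← abs_mul, ← Finset.sum_sub_distrib, Finset.mul_sum]
        congr 1
        refine Finset.sum_congr rfl fun t _ => ?_
        have h2 : (√2 / 2 : ℝ) ^ 2 = 1 / 2 := by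
          rw [div_pow, Real.sq_sqrt (by norm_num)]; norm_num
        simp only [ContinuousLinearMap.rotation_apply, Real.cos_pi_div_four, Real.sin_pi_div_four,
          Pi.add_apply, Pi.smul_apply, inner_add_right, real_inner_smul_right]
        linear_combination 4 * ⟪u i, z.1 t⟫ * ⟪u i, z.2 t⟫ * h2
    _ = _ := integral_const_mul _ _

end Decoupling

section Chaos

variable {ι V : Type*} [Fintype ι] [NormedAddCommGroup V] [InnerProductSpace ℝ V]
  [CompleteSpace V] [SecondCountableTopology V] [MeasurableSpace V] [BorelSpace V]

variable {I : Type*} [Fintype I] [Nonempty I]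

/-- The largest of the quadratic forms `∑ t, ⟪u i, B t⟫ ^ 2`. -/
def maxQuadratic (u : I → V) (B : ι → V) : ℝ :=
  Finset.univ.sup' Finset.univ_nonempty fun i => ∑ t, ⟪u i, B t⟫ ^ 2

/-- Squared length bounding the comparison process for the chaos. -/
def chaosEnvelope (p : ℝ) (u : I → V) (B : ι → V) (z : EuclideanSpace ℝ ι × V) : ℝ :=
  p ^ 2 * ‖∑ t, z.1 t • B t‖ ^ 2 + maxQuadratic u B * ‖z.2‖ ^ 2 +
    2 * p * (√(maxQuadratic u B) * |⟪∑ t, z.1 t • B t, z.2⟫|)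

theorem maxQuadratic_nonneg (u : I → V) (B : ι → V) : 0 ≤ maxQuadratic u B := by
  obtain ⟨i⟩ := ‹Nonempty I›
  exact (Finset.sum_nonneg fun _ _ => sq_nonneg _).trans
    (Finset.le_sup' (fun i => ∑ t, ⟪u i, B t⟫ ^ 2) (Finset.mem_univ i))

theorem chaosEnvelope_nonneg {p : ℝ} (hp : 0 ≤ p) (u : I → V) (B : ι → V)
    (z : EuclideanSpace ℝ ι × V) : 0 ≤ chaosEnvelope p u B z := by
  have := maxQuadratic_nonneg u B
  unfold chaosEnvelope
  positivity

theorem polyGrowth_maxQuadratic (u : I → V) :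
    PolyGrowth fun B : ι → V => maxQuadratic u B :=
  .sup fun i => .sum _ fun t => ((PolyGrowth.const (u i)).inner (polyGrowth_eval t)).sq

theorem abs_bilinear_le_sqrt_chaosEnvelope {p a : ℝ} {u : I → V} (B : ι → V) (i : I)
    (hu : ‖u i‖ = 1) (ha0 : 0 ≤ a) (hap : a ≤ p) {s : ℝ} (hs : |s| = 1)
    (z : EuclideanSpace ℝ ι × V) :
    a * ∑ t, (s * ⟪u i, B t⟫) * z.1 t + √(∑ t, ⟪u i, B t⟫ ^ 2) * ⟪u i, z.2⟫ ≤
      √(chaosEnvelope p u B z) := by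
  set b := √(∑ t, ⟪u i, B t⟫ ^ 2) with hb
  have hb0 : 0 ≤ b := Real.sqrt_nonneg _
  have hQ0 := maxQuadratic_nonneg u B
  have hbsq : b ^ 2 ≤ maxQuadratic u B := by
    rw [hb, Real.sq_sqrt (Finset.sum_nonneg fun _ _ => sq_nonneg _)]
    exact Finset.le_sup' (fun i => ∑ t, ⟪u i, B t⟫ ^ 2) (Finset.mem_univ i)
  have hbQ : b ≤ √(maxQuadratic u B) := Real.le_sqrt_of_sq_le hbsq
  have e : a * ∑ t, (s * ⟪u i, B t⟫) * z.1 t + b * ⟪u i, z.2⟫ =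
      ⟪u i, (a * s) • ∑ t, z.1 t • B t + b • z.2⟫ := by
    rw [inner_add_right, real_inner_smul_right, real_inner_smul_right, inner_sum,
      Finset.mul_sum, Finset.mul_sum]
    congr 1
    exact Finset.sum_congr rfl fun t _ => by rw [real_inner_smul_right]; ring
  rw [e]
  refine (real_inner_le_norm _ _).trans ?_
  rw [hu, one_mul]
  refine Real.le_sqrt_of_sq_le ?_
  rw [norm_add_sq_real, norm_smul, norm_smul, Real.norm_eq_abs, Real.norm_of_nonneg hb0, abs_mul,
    hs, abs_of_nonneg ha0, real_inner_smul_left, real_inner_smul_right, mul_one, mul_pow, mul_pow]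
  set X := ⟪∑ t, z.1 t • B t, z.2⟫
  have h1 : a * s * (b * X) ≤ p * (√(maxQuadratic u B) * |X|) := by
    calc a * s * (b * X) ≤ |a * s * (b * X)| := le_abs_self _
      _ = a * (b * |X|) := by
        rw [abs_mul, abs_mul, abs_mul, hs, abs_of_nonneg ha0, abs_of_nonneg hb0, mul_one]
      _ ≤ _ := by
        have := ha0.trans hap
        gcongr
  have h2 : a ^ 2 * ‖∑ t, z.1 t • B t‖ ^ 2 ≤ p ^ 2 * ‖∑ t, z.1 t • B t‖ ^ 2 := by gcongr
  have h3 : b ^ 2 * ‖z.2‖ ^ 2 ≤ maxQuadratic u B * ‖z.2‖ ^ 2 := by gcongr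
  unfold chaosEnvelope
  linarith

theorem polyGrowth_coord_fst (t : ι) :
    PolyGrowth fun z : EuclideanSpace ℝ ι × V => z.1 t :=
  .of_clm ((EuclideanSpace.proj t : EuclideanSpace ℝ ι →L[ℝ] ℝ).comp
    (ContinuousLinearMap.fst ℝ (EuclideanSpace ℝ ι) V))

theorem polyGrowth_coord_snd_fst {W : Type*} [NormedAddCommGroup W] [NormedSpace ℝ W] (t : ι) :
    PolyGrowth fun z : W × EuclideanSpace ℝ ι × V => z.2.1 t :=
  .of_clm ((EuclideanSpace.proj t : EuclideanSpace ℝ ι →L[ℝ] ℝ).comp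
    ((ContinuousLinearMap.fst ℝ (EuclideanSpace ℝ ι) V).comp
      (ContinuousLinearMap.snd ℝ W (EuclideanSpace ℝ ι × V))))

theorem polyGrowth_snd {W W' : Type*} [NormedAddCommGroup W] [NormedSpace ℝ W]
    [NormedAddCommGroup W'] [NormedSpace ℝ W'] : PolyGrowth fun z : W × W' => z.2 :=
  .of_clm (ContinuousLinearMap.snd ℝ W W')

theorem polyGrowth_snd_snd {W W' W'' : Type*} [NormedAddCommGroup W] [NormedSpace ℝ W]
    [NormedAddCommGroup W'] [NormedSpace ℝ W'] [NormedAddCommGroup W''] [NormedSpace ℝ W''] :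
    PolyGrowth fun z : W × W' × W'' => z.2.2 :=
  .of_clm ((ContinuousLinearMap.snd ℝ W' W'').comp (ContinuousLinearMap.snd ℝ W (W' × W'')))

theorem polyGrowth_gaussianSum :
    PolyGrowth fun w : (ι → V) × EuclideanSpace ℝ ι × V => ∑ t, w.2.1 t • w.1 t :=
  .sum _ fun t => (polyGrowth_coord_snd_fst t).smul (polyGrowth_eval_fst t)

theorem polyGrowth_maxQuadratic_fst {W : Type*} [NormedAddCommGroup W] [NormedSpace ℝ W]
    (u : I → V) : PolyGrowth fun w : (ι → V) × W => maxQuadratic u w.1 :=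
  .sup fun i => .sum _ fun t => ((PolyGrowth.const (u i)).inner (polyGrowth_eval_fst t)).sq

theorem polyGrowth_chaosEnvelope (p : ℝ) (u : I → V) :
    PolyGrowth fun w : (ι → V) × EuclideanSpace ℝ ι × V => chaosEnvelope p u w.1 w.2 := by
  unfold chaosEnvelope
  exact (((PolyGrowth.const _).mul polyGrowth_gaussianSum.norm.sq).add
    ((polyGrowth_maxQuadratic_fst u).mul polyGrowth_snd_snd.norm.sq)).add
    ((PolyGrowth.const _).mul ((polyGrowth_maxQuadratic_fst u).sqrt.mul
      (polyGrowth_gaussianSum.inner polyGrowth_snd_snd).abs))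

/-- For fixed `B`, the supremum of the decoupled chaos is bounded by a Gaussian average. -/
theorem integral_sup_abs_bilinear_le {μ : Measure (ι → V)} {ν : Measure V} [IsGaussian μ]
    [IsGaussian ν] (hμ : ∀ L : StrongDual ℝ (ι → V), μ[L] = 0)
    (hν : ∀ L : StrongDual ℝ V, ν[L] = 0)
    (hdom : ∀ c : ι → V, ∫ A, (∑ t, ⟪c t, A t⟫) ^ 2 ∂μ ≤ ∑ t, ∫ k, ⟪c t, k⟫ ^ 2 ∂ν)
    {p : ℝ} (hp : 0 ≤ p) (hνp : ∀ v, ∫ k, ⟪v, k⟫ ^ 2 ∂ν ≤ p ^ 2 * ‖v‖ ^ 2)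
    {u : I → V} (hu : ∀ i, ‖u i‖ = 1) (B : ι → V) :
    ∫ A, Finset.univ.sup' Finset.univ_nonempty (fun i => |∑ t, ⟪u i, B t⟫ * ⟪u i, A t⟫|) ∂μ ≤
      ∫ z, √(chaosEnvelope p u B z) ∂((stdGaussian (EuclideanSpace ℝ ι)).prod ν) := by
  set s : Bool → ℝ := fun b => if b then 1 else -1 with hs
  have hs1 : ∀ b, |s b| = 1 := fun b => by cases b <;> simp [hs]
  set w : I × Bool → V := fun j => u j.1
  set q : I × Bool → EuclideanSpace ℝ ι := fun j => WithLp.toLp 2 fun t => s j.2 * ⟪u j.1, B t⟫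
    with hq
  have hqn : ∀ j, ‖q j‖ = √(∑ t, ⟪u j.1, B t⟫ ^ 2) := fun j => by
    rw [EuclideanSpace.norm_eq]
    congr 1
    exact Finset.sum_congr rfl fun t _ => by simp [hq, hs1]
  have hG : PolyGrowth fun z : EuclideanSpace ℝ ι × V => chaosEnvelope p u B z := by
    unfold chaosEnvelope
    have h1 : PolyGrowth fun z : EuclideanSpace ℝ ι × V => ∑ t, z.1 t • B t :=
      .sum _ fun t => (polyGrowth_coord_fst t).smul (.const _)
    exact (((PolyGrowth.const _).mul h1.norm.sq).add
      ((PolyGrowth.const _).mul polyGrowth_snd.norm.sq)).add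
      ((PolyGrowth.const _).mul ((PolyGrowth.const _).mul (h1.inner polyGrowth_snd).abs))
  calc _ ≤ ∫ A, Finset.univ.sup' Finset.univ_nonempty
        (fun j => ∑ t, q j t * ⟪w j, A t⟫) ∂μ := by
        have hlin : ∀ v : V, ∀ t : ι, PolyGrowth fun A : ι → V => ⟪v, A t⟫ := fun v t =>
          (PolyGrowth.const v).inner (polyGrowth_eval t)
        refine integral_mono ((PolyGrowth.sup fun i => (PolyGrowth.sum _ fun t =>
          (PolyGrowth.const _).mul (hlin (u i) t)).abs).integrable μ)
          ((PolyGrowth.sup fun j => PolyGrowth.sum _ fun t =>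
          (PolyGrowth.const _).mul (hlin (w j) t)).integrable μ) fun A => ?_
        refine Finset.sup'_le _ _ fun i _ => ?_
        have hle : ∀ b, s b * ∑ t, ⟪u i, B t⟫ * ⟪u i, A t⟫ ≤ Finset.univ.sup'
            Finset.univ_nonempty (fun j => ∑ t, q j t * ⟪w j, A t⟫) := fun b => by
          refine le_trans (le_of_eq ?_)
            (Finset.le_sup' (fun j => ∑ t, q j t * ⟪w j, A t⟫) (Finset.mem_univ (i, b)))
          rw [Finset.mul_sum]
          exact Finset.sum_congr rfl fun t _ => by simp [hq, w, mul_assoc]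
        refine abs_le'.2 ⟨?_, ?_⟩
        · simpa [hs] using hle true
        · simpa [hs] using hle false
    _ ≤ ∫ z, Finset.univ.sup' Finset.univ_nonempty (fun j =>
        √(∫ k, ⟪w j, k⟫ ^ 2 ∂ν) * ⟪q j, z.1⟫ + ‖q j‖ * ⟪w j, z.2⟫)
        ∂((stdGaussian (EuclideanSpace ℝ ι)).prod ν) := integral_sup_bilinear_le hμ hν hdom w q
    _ ≤ _ := by
        have hfst : PolyGrowth fun z : EuclideanSpace ℝ ι × V => z.1 :=
          .of_clm (ContinuousLinearMap.fst ℝ (EuclideanSpace ℝ ι) V)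
        have hM : ∀ j, PolyGrowth fun z : EuclideanSpace ℝ ι × V =>
            √(∫ k, ⟪w j, k⟫ ^ 2 ∂ν) * ⟪q j, z.1⟫ + ‖q j‖ * ⟪w j, z.2⟫ := fun j =>
          ((PolyGrowth.const _).mul ((PolyGrowth.const (q j)).inner hfst)).add
            ((PolyGrowth.const _).mul ((PolyGrowth.const (w j)).inner polyGrowth_snd))
        refine integral_mono ((PolyGrowth.sup hM).integrable _) (hG.sqrt.integrable _) fun z => ?_
        refine Finset.sup'_le _ _ fun j _ => ?_
        have h := abs_bilinear_le_sqrt_chaosEnvelope B j.1 (hu j.1)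
          (Real.sqrt_nonneg (∫ k, ⟪w j, k⟫ ^ 2 ∂ν))
          (Real.sqrt_le_iff.2 ⟨hp, by simpa [w, hu] using hνp (w j)⟩) (hs1 j.2) z
        refine le_trans (le_of_eq ?_) h
        rw [hqn]
        congr 2
        rw [PiLp.inner_apply]
        exact Finset.sum_congr rfl fun t _ => by simp [hq, mul_comm]

end Chaos

section ChaosBound

variable {ι V : Type*} [Fintype ι] [NormedAddCommGroup V] [InnerProductSpace ℝ V]
  [CompleteSpace V] [SecondCountableTopology V] [MeasurableSpace V] [BorelSpace V]

variable {I : Type*} [Fintype I] [Nonempty I]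

theorem integral_stdGaussian_sum_mul_sq (c : ι → ℝ) :
    ∫ y, (∑ t, y t * c t) ^ 2 ∂(stdGaussian (EuclideanSpace ℝ ι)) = ∑ t, c t ^ 2 := by
  have h := integral_stdGaussian_inner_mul_inner (WithLp.toLp 2 c) (WithLp.toLp 2 c)
  simp only [PiLp.inner_apply, RCLike.inner_apply, conj_trivial, ← sq] at h
  exact h

theorem polyGrowth_coord (t : ι) : PolyGrowth fun y : EuclideanSpace ℝ ι => y t :=
  .of_clm (EuclideanSpace.proj t : EuclideanSpace ℝ ι →L[ℝ] ℝ)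

theorem integral_stdGaussian_norm_sum_smul_sq (B : ι → V) :
    ∫ y, ‖∑ t, y t • B t‖ ^ 2 ∂(stdGaussian (EuclideanSpace ℝ ι)) = ∑ t, ‖B t‖ ^ 2 := by
  classical
  have h : ∀ s t : ι, ∫ y : EuclideanSpace ℝ ι, y s * y t ∂(stdGaussian (EuclideanSpace ℝ ι)) =
      if s = t then 1 else 0 := fun s t => by
    have h := integral_stdGaussian_inner_mul_inner (EuclideanSpace.single s 1 : EuclideanSpace ℝ ι)
      (EuclideanSpace.single t 1)
    simpa [EuclideanSpace.inner_single_left, Pi.single_apply] using h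
  have e : ∀ y : EuclideanSpace ℝ ι, ‖∑ t, y t • B t‖ ^ 2 =
      ∑ s, ∑ t, (y s * y t) * ⟪B s, B t⟫ := fun y => by
    rw [← real_inner_self_eq_norm_sq, sum_inner]
    refine Finset.sum_congr rfl fun s _ => ?_
    rw [inner_sum]
    refine Finset.sum_congr rfl fun t _ => ?_
    rw [real_inner_smul_left, real_inner_smul_right, mul_assoc]
  have hi : ∀ s t, PolyGrowth fun y : EuclideanSpace ℝ ι => (y s * y t) * ⟪B s, B t⟫ := fun s t =>
    ((polyGrowth_coord s).mul (polyGrowth_coord t)).mul (.const _)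
  simp_rw [e]
  rw [integral_finsetSum _ fun s _ => (PolyGrowth.sum _ (hi s)).integrable _]
  refine Finset.sum_congr rfl fun s _ => ?_
  rw [integral_finsetSum _ fun t _ => (hi s t).integrable _]
  simp [integral_mul_const, h]

theorem integral_norm_gaussianSum_sq {μ : Measure (ι → V)} {ν : Measure V} [IsGaussian μ]
    [IsGaussian ν] :
    ∫ w : (ι → V) × EuclideanSpace ℝ ι × V, ‖∑ t, w.2.1 t • w.1 t‖ ^ 2
      ∂(μ.prod ((stdGaussian (EuclideanSpace ℝ ι)).prod ν)) = ∫ A, ∑ t, ‖A t‖ ^ 2 ∂μ := by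
  rw [integral_prod _ (polyGrowth_gaussianSum.norm.sq.integrable _)]
  congr 1
  ext B
  rw [integral_fun_fst (μ := stdGaussian (EuclideanSpace ℝ ι)) (ν := ν)
    (fun y => ‖∑ t, y t • B t‖ ^ 2), integral_stdGaussian_norm_sum_smul_sq]
  simp

theorem integral_inner_gaussianSum_sq_le {μ : Measure (ι → V)} {ν : Measure V} [IsGaussian μ]
    [IsGaussian ν] {S T : ℝ} (hS : 0 ≤ S)
    (hμS : ∀ v, ∫ A, ∑ t, ⟪v, A t⟫ ^ 2 ∂μ ≤ S * ‖v‖ ^ 2) (hνT : ∫ k, ‖k‖ ^ 2 ∂ν ≤ T) :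
    ∫ w : (ι → V) × EuclideanSpace ℝ ι × V, ⟪∑ t, w.2.1 t • w.1 t, w.2.2⟫ ^ 2
      ∂(μ.prod ((stdGaussian (EuclideanSpace ℝ ι)).prod ν)) ≤ S * T := by
  have hsnd : PolyGrowth fun k : V => k := .of_clm (ContinuousLinearMap.id ℝ V)
  rw [integral_prod _ ((polyGrowth_gaussianSum.inner polyGrowth_snd_snd).sq.integrable _)]
  have e : ∀ B : ι → V, ∫ z : EuclideanSpace ℝ ι × V, ⟪∑ t, z.1 t • B t, z.2⟫ ^ 2
      ∂((stdGaussian (EuclideanSpace ℝ ι)).prod ν) = ∫ k, ∑ t, ⟪k, B t⟫ ^ 2 ∂ν := fun B => by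
    have h1 : PolyGrowth fun z : EuclideanSpace ℝ ι × V => ⟪∑ t, z.1 t • B t, z.2⟫ ^ 2 :=
      ((PolyGrowth.sum _ fun t => (polyGrowth_coord_fst t).smul (.const (B t))).inner
        polyGrowth_snd).sq
    rw [integral_prod_symm _ (h1.integrable _)]
    congr 1
    ext k
    rw [← integral_stdGaussian_sum_mul_sq]
    simp_rw [sum_inner, real_inner_smul_left, real_inner_comm]
  simp_rw [e]
  have hF : PolyGrowth fun w : (ι → V) × V => ∑ t, ⟪w.2, w.1 t⟫ ^ 2 :=
    .sum _ fun t => (polyGrowth_snd.inner (polyGrowth_eval_fst t)).sq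
  rw [integral_integral_swap (hF.integrable (μ.prod ν))]
  calc ∫ k, ∫ B, ∑ t, ⟪k, B t⟫ ^ 2 ∂μ ∂ν ≤ ∫ k, S * ‖k‖ ^ 2 ∂ν :=
        integral_mono (hF.integrable (μ.prod ν)).integral_prod_right
          (((PolyGrowth.const S).mul hsnd.norm.sq).integrable ν) hμS
    _ = S * ∫ k, ‖k‖ ^ 2 ∂ν := integral_const_mul _ _
    _ ≤ S * T := mul_le_mul_of_nonneg_left hνT hS

theorem le_of_sq_le_chaos_bound {D S T a : ℝ} (hS : 0 ≤ S) (hT : 0 ≤ T) (ha : 0 ≤ a) (hD0 : 0 ≤ D)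
    (hD : D ^ 2 ≤ 4 * (a ^ 2 + T * (√(S + D) + √S) ^ 2)) :
    D ≤ 4 * T + 4 * √(T * S) + 2 * √2 * a := by
  obtain ⟨r, hr, rfl⟩ : ∃ r, 0 ≤ r ∧ T = r ^ 2 := ⟨√T, Real.sqrt_nonneg _, (Real.sq_sqrt hT).symm⟩
  obtain ⟨s, hs, rfl⟩ : ∃ s, 0 ≤ s ∧ S = s ^ 2 := ⟨√S, Real.sqrt_nonneg _, (Real.sq_sqrt hS).symm⟩
  rw [Real.sqrt_sq hs] at hD
  rw [← mul_pow, Real.sqrt_sq (by positivity)]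
  obtain ⟨y, hy0, hy⟩ : ∃ y, 0 ≤ y ∧ √(s ^ 2 + D) = y := ⟨_, Real.sqrt_nonneg _, rfl⟩
  have hy2 : y ^ 2 = s ^ 2 + D := by rw [← hy]; exact Real.sq_sqrt (by positivity)
  rw [hy] at hD
  clear hy
  obtain rfl : D = y ^ 2 - s ^ 2 := by linarith
  have hys : s ≤ y := le_of_sq_le_sq (by linarith) hy0
  have h2 : √2 ^ 2 = (2 : ℝ) := Real.sq_sqrt (by norm_num)
  by_contra! hlt
  have h3 : 2 * √2 * a < (y - s - 2 * r) * (y + s + 2 * r) := by linarith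
  have h30 : 0 ≤ 2 * √2 * a := by positivity
  have he : 0 < y - s - 2 * r := by
    by_contra! hneg
    nlinarith [mul_nonneg (neg_nonneg.2 hneg) (show 0 ≤ y + s + 2 * r by positivity)]
  obtain ⟨e, rfl⟩ : ∃ e, y = s + 2 * r + e := ⟨y - s - 2 * r, by ring⟩
  have he' : 0 < e := by linarith
  have h4 : 8 * a ^ 2 < (e * (2 * s + 4 * r + e)) ^ 2 := by
    calc 8 * a ^ 2 = (2 * √2 * a) ^ 2 := by rw [mul_pow, mul_pow, h2]; ring
      _ < _ := by
        refine pow_lt_pow_left₀ ?_ h30 (by norm_num)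
        calc _ < _ := h3
          _ = _ := by ring
  have h5 : ((2 * r + e) ^ 2 - 4 * r ^ 2) * (2 * s + 2 * r + e) ^ 2 ≤ 4 * a ^ 2 := by
    linarith [hD]
  have h6 : (e * (2 * s + 4 * r + e)) ^ 2 ≤
      2 * (((2 * r + e) ^ 2 - 4 * r ^ 2) * (2 * s + 2 * r + e) ^ 2) := by
    have : 0 ≤ 2 * (((2 * r + e) ^ 2 - 4 * r ^ 2) * (2 * s + 2 * r + e) ^ 2) -
      (e * (2 * s + 4 * r + e)) ^ 2 := by
      ring_nf
      positivity
    linarith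
  linarith

/-- Bound for the expected supremum of a centered quadratic Gaussian chaos. -/
theorem integral_sup_abs_quadratic_le {μ : Measure (ι → V)} {ν : Measure V} [IsGaussian μ]
    [IsGaussian ν] (hμ : ∀ L : StrongDual ℝ (ι → V), μ[L] = 0)
    (hν : ∀ L : StrongDual ℝ V, ν[L] = 0)
    (hdom : ∀ c : ι → V, ∫ A, (∑ t, ⟪c t, A t⟫) ^ 2 ∂μ ≤ ∑ t, ∫ k, ⟪c t, k⟫ ^ 2 ∂ν)
    {p S T τ : ℝ} (hp : 0 ≤ p) (hS : 0 ≤ S) (hpT : p ^ 2 ≤ T)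
    (hνp : ∀ v, ∫ k, ⟪v, k⟫ ^ 2 ∂ν ≤ p ^ 2 * ‖v‖ ^ 2) (hνT : ∫ k, ‖k‖ ^ 2 ∂ν ≤ T)
    (hμS : ∀ v, ∫ A, ∑ t, ⟪v, A t⟫ ^ 2 ∂μ ≤ S * ‖v‖ ^ 2)
    (hμτ : ∫ A, ∑ t, ‖A t‖ ^ 2 ∂μ ≤ τ) {u : I → V} (hu : ∀ i, ‖u i‖ = 1) :
    ∫ A, Finset.univ.sup' Finset.univ_nonempty (fun i =>
        |∑ t, ⟪u i, A t⟫ ^ 2 - ∫ A, ∑ t, ⟪u i, A t⟫ ^ 2 ∂μ|) ∂μ ≤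
      4 * T + 4 * √(T * S) + 2 * √2 * (p * √τ) := by
  set ρ := μ.prod ((stdGaussian (EuclideanSpace ℝ ι)).prod ν) with hρ
  set D := ∫ A, Finset.univ.sup' Finset.univ_nonempty (fun i =>
        |∑ t, ⟪u i, A t⟫ ^ 2 - ∫ A, ∑ t, ⟪u i, A t⟫ ^ 2 ∂μ|) ∂μ with hDdef
  have hT : 0 ≤ T := (sq_nonneg p).trans hpT
  have hτ : 0 ≤ τ := (integral_nonneg fun A => Finset.sum_nonneg fun _ _ => sq_nonneg _).trans hμτ
  have hβ : ∀ i, PolyGrowth fun A : ι → V => ∑ t, ⟪u i, A t⟫ ^ 2 := fun i =>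
    .sum _ fun t => ((PolyGrowth.const (u i)).inner (polyGrowth_eval t)).sq
  have hdev : PolyGrowth fun A : ι → V => Finset.univ.sup' Finset.univ_nonempty (fun i =>
        |∑ t, ⟪u i, A t⟫ ^ 2 - ∫ A, ∑ t, ⟪u i, A t⟫ ^ 2 ∂μ|) :=
    .sup fun i => ((hβ i).sub (.const _)).abs
  have hD0 : 0 ≤ D := integral_nonneg fun A => by
    obtain ⟨i⟩ := ‹Nonempty I›
    exact (abs_nonneg _).trans (Finset.le_sup' (fun i =>
        |∑ t, ⟪u i, A t⟫ ^ 2 - ∫ A, ∑ t, ⟪u i, A t⟫ ^ 2 ∂μ|) (Finset.mem_univ i))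
  have hQint : ∫ A, maxQuadratic u A ∂μ ≤ S + D := by
    have e : S + D = ∫ A, (S + Finset.univ.sup' Finset.univ_nonempty (fun i =>
        |∑ t, ⟪u i, A t⟫ ^ 2 - ∫ A, ∑ t, ⟪u i, A t⟫ ^ 2 ∂μ|)) ∂μ := by
      rw [integral_add (integrable_const _) (hdev.integrable μ)]
      simp [hDdef]
    rw [e]
    refine integral_mono ((polyGrowth_maxQuadratic u).integrable μ)
      (((PolyGrowth.const S).add hdev).integrable μ) fun A => ?_
    refine Finset.sup'_le _ _ fun i hi => ?_
    have h1 := Finset.le_sup' (fun i =>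
        |∑ t, ⟪u i, A t⟫ ^ 2 - ∫ A, ∑ t, ⟪u i, A t⟫ ^ 2 ∂μ|) hi
    have h2 := le_abs_self (∑ t, ⟪u i, A t⟫ ^ 2 - ∫ A, ∑ t, ⟪u i, A t⟫ ^ 2 ∂μ)
    have h3 := hμS (u i)
    rw [hu] at h3
    simp only at h1 ⊢
    linarith
  set m := √(∫ A, maxQuadratic u A ∂μ) with hm
  have hm0 : 0 ≤ m := Real.sqrt_nonneg _
  have hmsq : m ^ 2 = ∫ A, maxQuadratic u A ∂μ :=
    Real.sq_sqrt (integral_nonneg fun A => maxQuadratic_nonneg u A)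
  have hmy : m ≤ √(S + D) := Real.sqrt_le_sqrt hQint
  have hR := polyGrowth_chaosEnvelope (ι := ι) p u
  have hDR : D ≤ 2 * ∫ w, √(chaosEnvelope p u w.1 w.2) ∂ρ := by
    refine (integral_sup_abs_quadratic_sub_le hμ u).trans ?_
    refine mul_le_mul_of_nonneg_left ?_ zero_le_two
    have hΓ : PolyGrowth fun z : (ι → V) × (ι → V) => Finset.univ.sup' Finset.univ_nonempty
        (fun i => |∑ t, ⟪u i, z.1 t⟫ * ⟪u i, z.2 t⟫|) :=
      .sup fun i => (PolyGrowth.sum _ fun t =>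
        ((PolyGrowth.const (u i)).inner (polyGrowth_eval_fst t)).mul
        ((PolyGrowth.const (u i)).inner (polyGrowth_eval_snd t))).abs
    rw [integral_prod _ (hΓ.integrable _), hρ, integral_prod _ (hR.sqrt.integrable _)]
    exact integral_mono (hΓ.integrable _).integral_prod_left
      (hR.sqrt.integrable (μ.prod _)).integral_prod_left
      fun B => integral_sup_abs_bilinear_le hμ hν hdom hp hνp hu B
  have hjensen : (∫ w, √(chaosEnvelope p u w.1 w.2) ∂ρ) ^ 2 ≤ ∫ w, chaosEnvelope p u w.1 w.2 ∂ρ := by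
    have h := integral_mul_sq_le (ρ := ρ) (f := fun w => √(chaosEnvelope p u w.1 w.2))
      (g := fun _ => 1) (hR.sqrt.sq.integrable _) (by simp) (by simpa using hR.sqrt.integrable _)
    simpa [Real.sq_sqrt (chaosEnvelope_nonneg hp u _ _)] using h
  have hX : PolyGrowth fun w : (ι → V) × EuclideanSpace ℝ ι × V =>
      ⟪∑ t, w.2.1 t • w.1 t, w.2.2⟫ := polyGrowth_gaussianSum.inner polyGrowth_snd_snd
  have hQ := polyGrowth_maxQuadratic_fst (ι := ι) (W := EuclideanSpace ℝ ι × V) u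
  have hcross : ∫ w, √(maxQuadratic u w.1) * |⟪∑ t, w.2.1 t • w.1 t, w.2.2⟫| ∂ρ ≤ m * √(S * T) := by
    refine le_of_sq_le_sq ?_ (by positivity)
    refine (integral_mul_sq_le (hQ.sqrt.sq.integrable _) (hX.abs.sq.integrable _)
      ((hQ.sqrt.mul hX.abs).integrable _)).trans ?_
    simp_rw [Real.sq_sqrt (maxQuadratic_nonneg u _), sq_abs]
    rw [mul_pow, hmsq, Real.sq_sqrt (by positivity),
      hρ, integral_fun_fst (μ := μ) (fun B => maxQuadratic u B)]
    simp only [probReal_univ, one_smul]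
    exact mul_le_mul_of_nonneg_left (integral_inner_gaussianSum_sq_le hS hμS hνT)
      (integral_nonneg fun A => maxQuadratic_nonneg u A)
  have hQk : ∫ w : (ι → V) × EuclideanSpace ℝ ι × V, maxQuadratic u w.1 * ‖w.2.2‖ ^ 2 ∂ρ ≤
      m ^ 2 * T := by
    rw [hρ, integral_prod_mul (fun B => maxQuadratic u B)
      (fun z : EuclideanSpace ℝ ι × V => ‖z.2‖ ^ 2), hmsq,
      integral_fun_snd (ν := ν) (fun k => ‖k‖ ^ 2)]
    simp only [probReal_univ, one_smul]
    exact mul_le_mul_of_nonneg_left hνT (integral_nonneg fun A => maxQuadratic_nonneg u A)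
  have hRint : ∫ w, chaosEnvelope p u w.1 w.2 ∂ρ ≤
      p ^ 2 * τ + m ^ 2 * T + 2 * p * (m * √(S * T)) := by
    have i1 : PolyGrowth fun w : (ι → V) × EuclideanSpace ℝ ι × V =>
        p ^ 2 * ‖∑ t, w.2.1 t • w.1 t‖ ^ 2 := (PolyGrowth.const _).mul polyGrowth_gaussianSum.norm.sq
    have i2 := hQ.mul (polyGrowth_snd_snd (W := ι → V) (W' := EuclideanSpace ℝ ι) (W'' := V)).norm.sq
    have i3 := (PolyGrowth.const (2 * p)).mul (hQ.sqrt.mul hX.abs)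
    unfold chaosEnvelope
    rw [integral_add ((i1.add i2).integrable _) (i3.integrable _),
      integral_add (i1.integrable _) (i2.integrable _), integral_const_mul, integral_const_mul,
      hρ, integral_norm_gaussianSum_sq, ← hρ]
    gcongr
  refine le_of_sq_le_chaos_bound hS hT (by positivity) hD0 ?_
  have hst : √(S * T) = √S * √T := Real.sqrt_mul hS T
  have hpr : p ≤ √T := Real.le_sqrt_of_sq_le hpT
  have hTT : √T * √T = T := Real.mul_self_sqrt hT
  have h1 : D ^ 2 ≤ 4 * (p ^ 2 * τ + m ^ 2 * T + 2 * p * (m * √(S * T))) := by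
    calc D ^ 2 ≤ (2 * ∫ w, √(chaosEnvelope p u w.1 w.2) ∂ρ) ^ 2 := pow_le_pow_left₀ hD0 hDR 2
      _ = 4 * (∫ w, √(chaosEnvelope p u w.1 w.2) ∂ρ) ^ 2 := by ring
      _ ≤ _ := by linarith
  refine h1.trans ?_
  rw [mul_pow p, Real.sq_sqrt hτ, hst]
  have h2 : m ^ 2 ≤ √(S + D) ^ 2 := by gcongr
  have h3 : p * (m * (√S * √T)) ≤ T * (√(S + D) * √S) := by
    calc p * (m * (√S * √T)) ≤ √T * (√(S + D) * (√S * √T)) := by gcongr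
      _ = (√T * √T) * (√(S + D) * √S) := by ring
      _ = _ := by rw [hTT]
  have h4 := mul_le_mul_of_nonneg_right h2 hT
  have h5 : 0 ≤ T * √S ^ 2 := by positivity
  have h6 : T * (√(S + D) + √S) ^ 2 =
      √(S + D) ^ 2 * T + 2 * (T * (√(S + D) * √S)) + T * √S ^ 2 := by ring
  linarith

end ChaosBound

section OperatorSeries

variable {H : Type*} [NormedAddCommGroup H] [InnerProductSpace ℝ H] [CompleteSpace H]

/-- The operator `u ↦ ∑ i, s i * ⟪f i, u⟫ • g i` as a continuous linear map. -/
def rankOneSeries (s : ℕ → ℝ) (f g : ℕ → H) : H →L[ℝ] H :=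
  ∑' i, s i • (innerSL ℝ (f i)).smulRight (g i)

variable {s : ℕ → ℝ} {f g : ℕ → H}

theorem norm_rankOne_le (hs0 : ∀ i, 0 ≤ s i) (hf : Orthonormal ℝ f) (hg : Orthonormal ℝ g) (i : ℕ) :
    ‖s i • (innerSL ℝ (f i)).smulRight (g i)‖ ≤ s i := by
  rw [norm_smul, ContinuousLinearMap.norm_smulRight_apply, innerSL_apply_norm, hf.1, hg.1,
    Real.norm_of_nonneg (hs0 i)]
  simp

theorem summable_rankOne (hs0 : ∀ i, 0 ≤ s i) (hs : Summable s) (hf : Orthonormal ℝ f)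
    (hg : Orthonormal ℝ g) : Summable fun i => s i • (innerSL ℝ (f i)).smulRight (g i) :=
  .of_norm_bounded hs (norm_rankOne_le hs0 hf hg)

theorem hasSum_rankOneSeries (hs0 : ∀ i, 0 ≤ s i) (hs : Summable s) (hf : Orthonormal ℝ f)
    (hg : Orthonormal ℝ g) (u : H) :
    HasSum (fun i => (s i * ⟪f i, u⟫) • g i) (rankOneSeries s f g u) := by
  have h := (summable_rankOne hs0 hs hf hg).hasSum.mapL (ContinuousLinearMap.apply ℝ H u)
  simpa [rankOneSeries, smul_smul] using h

theorem hasSum_inner_rankOneSeries (hs0 : ∀ i, 0 ≤ s i) (hs : Summable s) (hf : Orthonormal ℝ f)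
    (hg : Orthonormal ℝ g) (u v : H) :
    HasSum (fun i => s i * ⟪f i, u⟫ * ⟪g i, v⟫) ⟪rankOneSeries s f g u, v⟫ := by
  have h := (hasSum_rankOneSeries hs0 hs hf hg u).mapL (innerSL ℝ v)
  simpa [real_inner_comm, real_inner_smul_right] using h

theorem norm_rankOneSeries_le (hs0 : ∀ i, 0 ≤ s i) (hs : Summable s) (hf : Orthonormal ℝ f)
    (hg : Orthonormal ℝ g) : ‖rankOneSeries s f g‖ ≤ ∑' i, s i :=
  tsum_of_norm_bounded hs.hasSum (norm_rankOne_le hs0 hf hg)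

theorem inner_rankOneSeries_self_nonneg (hs0 : ∀ i, 0 ≤ s i) (hs : Summable s)
    (hf : Orthonormal ℝ f) (u : H) : 0 ≤ ⟪rankOneSeries s f f u, u⟫ := by
  rw [← (hasSum_inner_rankOneSeries hs0 hs hf hf u u).tsum_eq]
  exact tsum_nonneg fun i => by
    rw [mul_assoc]
    exact mul_nonneg (hs0 i) (mul_self_nonneg _)

theorem inner_rankOneSeries_self_comm (hs0 : ∀ i, 0 ≤ s i) (hs : Summable s)
    (hf : Orthonormal ℝ f) (u v : H) :
    ⟪rankOneSeries s f f u, v⟫ = ⟪rankOneSeries s f f v, u⟫ := by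
  rw [← (hasSum_inner_rankOneSeries hs0 hs hf hf u v).tsum_eq,
    ← (hasSum_inner_rankOneSeries hs0 hs hf hf v u).tsum_eq]
  exact tsum_congr fun i => by ring

theorem two_mul_inner_rankOneSeries_le (hs0 : ∀ i, 0 ≤ s i) (hs : Summable s)
    (hf : Orthonormal ℝ f) (hg : Orthonormal ℝ g) (u v : H) :
    2 * ⟪rankOneSeries s f g u, v⟫ ≤
      ⟪rankOneSeries s f f u, u⟫ + ⟪rankOneSeries s g g v, v⟫ := by
  refine hasSum_le (fun i => ?_) ((hasSum_inner_rankOneSeries hs0 hs hf hg u v).mul_left 2)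
    ((hasSum_inner_rankOneSeries hs0 hs hf hf u u).add
      (hasSum_inner_rankOneSeries hs0 hs hg hg v v))
  nlinarith [mul_nonneg (hs0 i) (sq_nonneg (⟪f i, u⟫ - ⟪g i, v⟫))]

/-- The trace of the compression to an orthonormal system is at most the sum of the weights. -/
theorem sum_inner_rankOneSeries_le {κ : Type*} [Fintype κ] (hs0 : ∀ i, 0 ≤ s i) (hs : Summable s)
    (hf : Orthonormal ℝ f) (hg : Orthonormal ℝ g) {v : κ → H} (hv : Orthonormal ℝ v) :
    ∑ j, ⟪rankOneSeries s f g (v j), v j⟫ ≤ ∑' i, s i := by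
  refine hasSum_le (fun i => ?_)
    (hasSum_sum fun j _ => hasSum_inner_rankOneSeries hs0 hs hf hg (v j) (v j)) hs.hasSum
  have bessel : ∀ w : H, ‖w‖ = 1 → ∑ j, ⟪w, v j⟫ ^ 2 ≤ 1 := fun w hw => by
    have := hv.sum_inner_products_le w (s := Finset.univ)
    simpa [hw, real_inner_comm, sq_abs] using this
  calc ∑ j, s i * ⟪f i, v j⟫ * ⟪g i, v j⟫
      ≤ ∑ j, s i * (1 / 2) * (⟪f i, v j⟫ ^ 2 + ⟪g i, v j⟫ ^ 2) := by
        refine Finset.sum_le_sum fun j _ => ?_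
        nlinarith [mul_nonneg (hs0 i) (sq_nonneg (⟪f i, v j⟫ - ⟪g i, v j⟫))]
    _ = s i * (1 / 2) * (∑ j, ⟪f i, v j⟫ ^ 2 + ∑ j, ⟪g i, v j⟫ ^ 2) := by
        rw [← Finset.mul_sum, Finset.sum_add_distrib]
    _ ≤ s i * (1 / 2) * (1 + 1) := by
        have := hs0 i
        gcongr
        · exact bessel _ (hf.1 i)
        · exact bessel _ (hg.1 i)
    _ = s i := by ring

end OperatorSeries

section LagSum

/-- Bound a symmetric double sum by its diagonal and its lagged off-diagonal majorants. -/
theorem sum_sum_le_sum_diag_add_lags {n : ℕ} (a : Fin n → Fin n → ℝ) (φ ψ : ℕ → Fin n → ℝ)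
    (ha : ∀ s t, a s t = a t s) (hφ : ∀ h t, 0 ≤ φ h t) (hψ : ∀ h t, 0 ≤ ψ h t)
    (h : ∀ s t : Fin n, t < s → 2 * a s t ≤ φ (s - t) s + ψ (s - t) t) :
    ∑ s, ∑ t, a s t ≤ ∑ t, (a t t + ∑ k ∈ Finset.Ico 1 n, (φ k t + ψ k t)) := by
  have split : ∀ s t, a s t =
      (if t = s then a s t else 0) + (if t < s then a s t else 0) +
        (if s < t then a t s else 0) := fun s t => by
    rcases lt_trichotomy t s with h | h | h
    · simp [h, h.ne, h.not_gt]
    · simp [h]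
    · simp [h, h.ne', h.not_gt, ha s t]
  have hsum : ∑ s, ∑ t, a s t = ∑ s, a s s + ∑ s, ∑ t, if t < s then 2 * a s t else 0 := by
    calc ∑ s, ∑ t, a s t = ∑ s, ∑ t, ((if t = s then a s t else 0) + (if t < s then a s t else 0) +
        (if s < t then a t s else 0)) := by simp_rw [← split]
      _ = _ := by
        simp only [Finset.sum_add_distrib]
        rw [Finset.sum_comm (f := fun s t => if s < t then a t s else 0), add_assoc,
          ← Finset.sum_add_distrib]
        congr 1
        · simp
        · refine Finset.sum_congr rfl fun s _ => ?_
          rw [← Finset.sum_add_distrib]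
          refine Finset.sum_congr rfl fun t _ => ?_
          split_ifs <;> ring
  have lags : ∀ (χ : ℕ → ℝ) (_ : ∀ k, 0 ≤ χ k) (S : Finset (Fin n)) (d : Fin n → ℕ),
      (∀ t ∈ S, d t ∈ Finset.Ico 1 n) → Set.InjOn d S →
      ∑ t ∈ S, χ (d t) ≤ ∑ k ∈ Finset.Ico 1 n, χ k := fun χ hχ S d hd hinj => by
    rw [← Finset.sum_image (f := χ) hinj]
    exact Finset.sum_le_sum_of_subset_of_nonneg (Finset.image_subset_iff.2 hd) fun k _ _ => hχ k
  have hoff : ∑ s, ∑ t, (if t < s then 2 * a s t else 0) ≤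
      ∑ t, ∑ k ∈ Finset.Ico 1 n, φ k t + ∑ t, ∑ k ∈ Finset.Ico 1 n, ψ k t := by
    calc ∑ s, ∑ t, (if t < s then 2 * a s t else 0)
        ≤ ∑ s : Fin n, ∑ t : Fin n, ((if t < s then φ (s - t) s else 0) + (if t < s then ψ (s - t) t else 0)) := by
          refine Finset.sum_le_sum fun s _ => Finset.sum_le_sum fun t _ => ?_
          split_ifs with hst
          · exact h s t hst
          · simp
      _ = ∑ s : Fin n, ∑ t : Fin n, (if t < s then φ (s - t) s else 0) +
          ∑ t : Fin n, ∑ s : Fin n, (if t < s then ψ (s - t) t else 0) := by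
          simp only [Finset.sum_add_distrib]
          rw [Finset.sum_comm (f := fun s t : Fin n => if t < s then ψ (s - t) t else 0)]
      _ ≤ _ := by
          refine add_le_add (Finset.sum_le_sum fun s _ => ?_) (Finset.sum_le_sum fun t _ => ?_)
          · rw [← Finset.sum_filter]
            refine lags (fun k => φ k s) (fun k => hφ k s) _ (fun t => (s : ℕ) - t) ?_ ?_
            · intro t ht
              have : t < s := by simpa using ht
              simp only [Finset.mem_Ico]
              omega
            · intro t ht t' ht' e
              have h1 : t < s := by simpa using ht
              have h2 : t' < s := by simpa using ht'
              simp only at e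
              omega
          · rw [← Finset.sum_filter]
            refine lags (fun k => ψ k t) (fun k => hψ k t) _ (fun s => (s : ℕ) - t) ?_ ?_
            · intro s hs
              have : t < s := by simpa using hs
              simp only [Finset.mem_Ico]
              omega
            · intro s hs s' hs' e
              have h1 : t < s := by simpa using hs
              have h2 : t < s' := by simpa using hs'
              simp only at e
              omega
  rw [hsum]
  simp only [Finset.sum_add_distrib]
  linarith

end LagSum

section GaussianConstruction

variable {κ : Type*} [Fintype κ]

/-- Every positive operator on a Euclidean space is the covariance of a centered Gaussian. -/
theorem exists_isGaussian_of_isPositive {K : EuclideanSpace ℝ κ →ₗ[ℝ] EuclideanSpace ℝ κ}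
    (hK : K.IsPositive) :
    ∃ ν : Measure (EuclideanSpace ℝ κ), IsGaussian ν ∧
      (∀ L : StrongDual ℝ (EuclideanSpace ℝ κ), ν[L] = 0) ∧
      ∀ v, ∫ k, ⟪v, k⟫ ^ 2 ∂ν = ⟪K v, v⟫ := by
  classical
  set b := EuclideanSpace.basisFun κ ℝ
  set M := K.toMatrix b.toBasis b.toBasis
  have hM : M.PosSemidef := (LinearMap.posSemidef_toMatrix_iff b).2 hK
  have hmean : ∫ k, k ∂(multivariateGaussian (0 : EuclideanSpace ℝ κ) M) = 0 :=
    integral_id_multivariateGaussian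
  refine ⟨multivariateGaussian 0 M, inferInstance, fun L => ?_, fun v => ?_⟩
  · rw [IsGaussian.integral_dual, hmean, map_zero]
  · have h := covarianceBilin_multivariateGaussian (μ := 0) hM v v
    rw [covarianceBilin_apply IsGaussian.memLp_two_id] at h
    simp only [id, hmean, sub_zero] at h
    simp_rw [sq, h]
    have e : M.mulVec v.ofLp = (K v).ofLp := by
      have := LinearMap.toMatrix_mulVec_repr b.toBasis b.toBasis K v
      ext i
      exact congrFun this i
    rw [e, EuclideanSpace.inner_eq_star_dotProduct]
    simp

end GaussianConstruction

section FiniteSample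

variable {H : Type*} [NormedAddCommGroup H] [InnerProductSpace ℝ H] [CompleteSpace H]
  {Ω : Type*} [MeasureSpace Ω] {n : ℕ} {X : Fin n → Ω → H}

/-- The family of vectors has jointly Gaussian centered linear functionals. -/
def JointlyGaussian (X : Fin n → Ω → H) : Prop :=
  ∀ w : Fin n → H, ∃ v : ℝ≥0, Measure.map (fun ω => ∑ t, ⟪w t, X t ω⟫) ℙ = gaussianReal 0 v

theorem JointlyGaussian.aemeasurable_sum_inner (hX : JointlyGaussian X) (w : Fin n → H) :
    AEMeasurable (fun ω => ∑ t, ⟪w t, X t ω⟫) ℙ := by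
  obtain ⟨v, hv⟩ := hX w
  exact aemeasurable_of_map_neZero (hv ▸ inferInstance)

theorem JointlyGaussian.aemeasurable_inner (hX : JointlyGaussian X) (t : Fin n) (w : H) :
    AEMeasurable (fun ω => ⟪w, X t ω⟫) ℙ := by
  have h := hX.aemeasurable_sum_inner (Pi.single t w)
  have e : ∀ ω, ∑ s, ⟪(Pi.single t w : Fin n → H) s, X s ω⟫ = ⟪w, X t ω⟫ := fun ω => by
    rw [Finset.sum_eq_single t]
    · simp
    · intro s _ hs
      simp [Pi.single_eq_of_ne hs]
    · simp
  simpa only [e] using h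

variable {κ : Type*} [Fintype κ] (J : EuclideanSpace ℝ κ →ₗᵢ[ℝ] H)

/-- The sample compressed to the range of an isometry. -/
def compressedSample (X : Fin n → Ω → H) (ω : Ω) : Fin n → EuclideanSpace ℝ κ :=
  fun t => J.toContinuousLinearMap.adjoint (X t ω)

theorem inner_compressedSample (v : EuclideanSpace ℝ κ) (ω : Ω) (t : Fin n) :
    ⟪v, compressedSample J X ω t⟫ = ⟪J v, X t ω⟫ :=
  ContinuousLinearMap.adjoint_inner_right J.toContinuousLinearMap v (X t ω)

theorem JointlyGaussian.aemeasurable_compressedSample (hX : JointlyGaussian X) :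
    AEMeasurable (compressedSample J X) ℙ := by
  classical
  refine aemeasurable_pi_iff.2 fun t => ?_
  have e : ∀ ω, compressedSample J X ω t =
      ∑ j, ⟪J (EuclideanSpace.basisFun κ ℝ j), X t ω⟫ • EuclideanSpace.basisFun κ ℝ j := fun ω => by
    simp_rw [← inner_compressedSample]
    exact ((EuclideanSpace.basisFun κ ℝ).sum_repr' _).symm
  simp_rw [e]
  exact Finset.aemeasurable_fun_sum _ fun j _ => (hX.aemeasurable_inner t _).smul_const _

theorem exists_dual_compressedSample (L : StrongDual ℝ (Fin n → EuclideanSpace ℝ κ)) :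
    ∃ w : Fin n → H, ∀ ω, L (compressedSample J X ω) = ∑ t, ⟪w t, X t ω⟫ := by
  refine ⟨fun t => J ((InnerProductSpace.toDual ℝ _).symm
    (L.comp (ContinuousLinearMap.single ℝ (fun _ : Fin n => EuclideanSpace ℝ κ) t))), fun ω => ?_⟩
  simp_rw [← inner_compressedSample, InnerProductSpace.toDual_symm_apply]
  simp only [ContinuousLinearMap.comp_apply, ContinuousLinearMap.single_apply]
  rw [← map_sum, Finset.univ_sum_single]

theorem JointlyGaussian.isGaussian_map (hX : JointlyGaussian X) :
    IsGaussian (Measure.map (compressedSample J X) ℙ) := by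
  refine isGaussian_of_map_eq_gaussianReal fun L => ?_
  obtain ⟨w, hw⟩ := exists_dual_compressedSample (X := X) J L
  obtain ⟨v, hv⟩ := hX w
  refine ⟨0, v, ?_⟩
  rw [AEMeasurable.map_map_of_aemeasurable L.continuous.aemeasurable
    (hX.aemeasurable_compressedSample J), ← hv]
  congr 1
  ext ω
  exact hw ω

theorem JointlyGaussian.integral_dual_map (hX : JointlyGaussian X)
    (L : StrongDual ℝ (Fin n → EuclideanSpace ℝ κ)) :
    (Measure.map (compressedSample J X) ℙ)[L] = 0 := by
  obtain ⟨w, hw⟩ := exists_dual_compressedSample (X := X) J L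
  obtain ⟨v, hv⟩ := hX w
  rw [integral_map (hX.aemeasurable_compressedSample J) L.continuous.aestronglyMeasurable]
  simp_rw [hw]
  rw [← integral_map (φ := fun ω => ∑ t, ⟪w t, X t ω⟫) (f := fun y => y)
    (hX.aemeasurable_sum_inner w) (by fun_prop), hv]
  exact integral_id_gaussianReal

/-- Expected supremum of the centered quadratic forms of a Gaussian sample over finitely many
unit vectors in a finite-dimensional subspace. -/
theorem integral_sup_abs_sum_sq_inner_le (hX : JointlyGaussian X) {Q : H →L[ℝ] H}
    (hQs : ∀ u v, ⟪Q u, v⟫ = ⟪u, Q v⟫) (hQ0 : ∀ u, 0 ≤ ⟪Q u, u⟫)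
    (hdom : ∀ w : Fin n → H, ∫ ω, (∑ t, ⟪w t, X t ω⟫) ^ 2 ≤ ∑ t, ⟪Q (w t), w t⟫)
    {p S T τ : ℝ} (hp : 0 ≤ p) (hS : 0 ≤ S) (hpT : p ^ 2 ≤ T)
    (hQp : ∀ u, ⟪Q u, u⟫ ≤ p ^ 2 * ‖u‖ ^ 2)
    (hQT : ∀ v : κ → H, Orthonormal ℝ v → ∑ j, ⟪Q (v j), v j⟫ ≤ T)
    (hXS : ∀ u, ∫ ω, ∑ t, ⟪u, X t ω⟫ ^ 2 ≤ S * ‖u‖ ^ 2)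
    (hXτ : ∀ v : κ → H, Orthonormal ℝ v → ∑ j, ∫ ω, ∑ t, ⟪v j, X t ω⟫ ^ 2 ≤ τ)
    (hXi : ∀ u t, Integrable fun ω => ⟪u, X t ω⟫ ^ 2)
    {I : Type*} [Fintype I] [Nonempty I] {u : I → EuclideanSpace ℝ κ} (hu : ∀ i, ‖u i‖ = 1) :
    ∫ ω, Finset.univ.sup' Finset.univ_nonempty (fun i =>
        |∑ t, ⟪J (u i), X t ω⟫ ^ 2 - ∫ ω, ∑ t, ⟪J (u i), X t ω⟫ ^ 2|) ≤
      4 * T + 4 * √(T * S) + 2 * √2 * (p * √τ) := by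
  classical
  set b := EuclideanSpace.basisFun κ ℝ
  have hJb : Orthonormal ℝ fun j => J (b j) := b.orthonormal.comp_linearIsometry J
  have hparseval : ∀ k : EuclideanSpace ℝ κ, ‖k‖ ^ 2 = ∑ j, ⟪b j, k⟫ ^ 2 := fun k =>
    (b.sum_sq_inner_right k).symm
  set P := J.toContinuousLinearMap.adjoint
  set K : EuclideanSpace ℝ κ →ₗ[ℝ] EuclideanSpace ℝ κ :=
    (P ∘L Q ∘L J.toContinuousLinearMap).toLinearMap with hKdef
  have hKJ : ∀ v w, ⟪K v, w⟫ = ⟪Q (J v), J w⟫ := fun v w =>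
    ContinuousLinearMap.adjoint_inner_left J.toContinuousLinearMap w (Q (J v))
  have hK : K.IsPositive := by
    refine ⟨fun v w => ?_, fun v => ?_⟩
    · rw [hKJ, hQs, ← real_inner_comm, ← hKJ, real_inner_comm]
    · rw [hKJ]
      exact hQ0 _
  obtain ⟨ν, hνG, hν0, hν⟩ := exists_isGaussian_of_isPositive hK
  set μ := Measure.map (compressedSample J X) ℙ with hμ
  have hA := hX.aemeasurable_compressedSample J
  have : IsGaussian μ := hX.isGaussian_map J
  have hμint : ∀ F : (Fin n → EuclideanSpace ℝ κ) → ℝ, Continuous F →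
      ∫ A, F A ∂μ = ∫ ω, F (compressedSample J X ω) := fun F hF =>
    integral_map hA hF.aestronglyMeasurable
  have hquad : ∀ v, ∫ A, ∑ t, ⟪v, A t⟫ ^ 2 ∂μ = ∫ ω, ∑ t, ⟪J v, X t ω⟫ ^ 2 := fun v => by
    rw [hμint _ (by fun_prop)]
    simp_rw [inner_compressedSample]
  have hμi : ∀ v t, Integrable (fun A : Fin n → EuclideanSpace ℝ κ => ⟪v, A t⟫ ^ 2) μ :=
    fun v t => by
    rw [hμ, integrable_map_measure (Continuous.aestronglyMeasurable (by fun_prop)) hA]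
    simpa only [Function.comp_def, inner_compressedSample] using hXi (J v) t
  have key := integral_sup_abs_quadratic_le (hX.integral_dual_map J) hν0 (fun c => ?_) hp hS hpT
    (fun v => ?_) ?_ (fun v => ?_) (μ := μ) (ν := ν) (τ := τ) (T := T) (S := S) (p := p) ?_ hu
  · simp_rw [hquad] at key
    rw [hμint _ ?_] at key
    · simpa only [inner_compressedSample] using key
    · exact Continuous.finset_sup'_apply _ fun i _ => by fun_prop
  · simp_rw [hν, hKJ]
    rw [hμint _ (by fun_prop)]
    simp_rw [inner_compressedSample]
    exact hdom _
  · rw [hν, hKJ]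
    simpa using hQp (J v)
  · simp_rw [hparseval]
    rw [integral_finsetSum _ fun j _ => ?_]
    · simp_rw [hν, hKJ]
      exact hQT _ hJb
    · exact (IsGaussian.memLp_dual ν (innerSL ℝ (b j)) 2 (by simp)).integrable_sq
  · rw [hquad]
    simpa using hXS (J v)
  · simp_rw [hparseval]
    calc ∫ A, ∑ t, ∑ j, ⟪b j, A t⟫ ^ 2 ∂μ = ∫ A, ∑ j, ∑ t, ⟪b j, A t⟫ ^ 2 ∂μ := by
          congr 1
          ext A
          exact Finset.sum_comm
      _ = ∑ j, ∫ A, ∑ t, ⟪b j, A t⟫ ^ 2 ∂μ :=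
          integral_finsetSum _ fun j _ => integrable_finsetSum _ fun t _ => hμi _ t
      _ ≤ τ := by
          simp_rw [hquad]
          exact hXτ _ hJb

end FiniteSample

section OpNorm

variable {H : Type*} [NormedAddCommGroup H] [InnerProductSpace ℝ H] [CompleteSpace H]

theorem opNormH_nonneg (T : H → H) : 0 ≤ opNormH T :=
  Real.sSup_nonneg (by rintro _ ⟨u, -, rfl⟩; exact norm_nonneg _)

theorem opNormH_le {T : H → H} {C : ℝ} (hC : 0 ≤ C) (h : ∀ u, ‖u‖ = 1 → ‖T u‖ ≤ C) :
    opNormH T ≤ C :=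
  Real.sSup_le (by rintro _ ⟨u, hu, rfl⟩; exact h u hu) hC

theorem opNormH_le_norm (T : H →L[ℝ] H) : opNormH T ≤ ‖T‖ :=
  opNormH_le (norm_nonneg T) fun u hu => by simpa [hu] using T.le_opNorm u

theorem norm_apply_le_opNormH (T : H →L[ℝ] H) {u : H} (hu : ‖u‖ = 1) : ‖T u‖ ≤ opNormH T :=
  le_csSup ⟨‖T‖, by rintro _ ⟨u, hu, rfl⟩; simpa [hu] using T.le_opNorm u⟩ ⟨u, hu, rfl⟩

theorem inner_apply_self_le_opNormH (T : H →L[ℝ] H) (u : H) :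
    ⟪T u, u⟫ ≤ opNormH T * ‖u‖ ^ 2 := by
  rcases eq_or_ne u 0 with rfl | hu
  · simp
  have hu' : ‖u‖ ≠ 0 := norm_ne_zero_iff.2 hu
  have h1 : ‖(‖u‖⁻¹ • u)‖ = 1 := by rw [norm_smul, norm_inv, norm_norm, inv_mul_cancel₀ hu']
  have h2 : ‖T u‖ ≤ opNormH T * ‖u‖ := by
    have h := norm_apply_le_opNormH T h1
    rw [map_smul, norm_smul, norm_inv, norm_norm] at h
    calc ‖T u‖ = ‖u‖⁻¹ * ‖T u‖ * ‖u‖ := by field_simp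
      _ ≤ _ := by gcongr
  calc ⟪T u, u⟫ ≤ ‖T u‖ * ‖u‖ := real_inner_le_norm _ _
    _ ≤ opNormH T * ‖u‖ * ‖u‖ := by gcongr
    _ = _ := by ring

/-- A symmetric operator whose quadratic form is bounded on a dense set of unit vectors is
bounded. -/
theorem opNormH_le_of_denseRange {T : H →L[ℝ] H} (hT : (T : H →ₗ[ℝ] H).IsSymmetric)
    {e : ℕ → Metric.sphere (0 : H) 1} (he : DenseRange e) {C : ℝ}
    (hC : ∀ k, |⟪T (e k), (e k : H)⟫| ≤ C) : opNormH T ≤ C := by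
  have hC0 : 0 ≤ C := (abs_nonneg _).trans (hC 0)
  have hall : ∀ u : Metric.sphere (0 : H) 1, |⟪T u, (u : H)⟫| ≤ C := fun u =>
    he.induction_on (p := fun u : Metric.sphere (0 : H) 1 => |⟪T u, (u : H)⟫| ≤ C) u
      (isClosed_le (by fun_prop) continuous_const) hC
  refine (opNormH_le_norm T).trans ?_
  rw [T.norm_eq_iSup_rayleighQuotient hT]
  refine ciSup_le fun u => ?_
  rcases eq_or_ne u 0 with rfl | hu
  · simpa using hC0
  have hu' : ‖u‖ ≠ 0 := norm_ne_zero_iff.2 hu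
  have h1 : ‖(‖u‖⁻¹ • u)‖ = 1 := by rw [norm_smul, norm_inv, norm_norm, inv_mul_cancel₀ hu']
  have h := hall ⟨‖u‖⁻¹ • u, by simpa using h1⟩
  rw [ContinuousLinearMap.rayleighQuotient, ContinuousLinearMap.reApplyInnerSelf_apply]
  simp only [map_smul, real_inner_smul_left, real_inner_smul_right] at h
  refine le_of_eq_of_le (congrArg abs ?_) h
  simp only [RCLike.re_to_real]
  field_simp

theorem integrable_sup' {Ω I : Type*} [MeasurableSpace Ω] {P : Measure Ω} [Fintype I] [Nonempty I]
    {F : I → Ω → ℝ} (hF : ∀ i, Integrable (F i) P) :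
    Integrable (fun ω => Finset.univ.sup' Finset.univ_nonempty fun i => F i ω) P := by
  have h := Finset.sup'_induction (s := Finset.univ) Finset.univ_nonempty F
    (p := fun G => Integrable G P) (fun _ h1 _ h2 => h1.sup h2) fun i _ => hF i
  convert h using 1
  ext ω
  rw [Finset.sup'_apply]

/-- Expected operator norm of a random symmetric operator from finite suprema of its quadratic
form. -/
theorem integral_opNormH_le [Nontrivial H] [SecondCountableTopology H] {Ω : Type*}
    [MeasurableSpace Ω] {P : Measure Ω} {T : Ω → H →L[ℝ] H}
    (hT : ∀ ω, (T ω : H →ₗ[ℝ] H).IsSymmetric)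
    (hTi : ∀ u, Integrable (fun ω => ⟪T ω u, u⟫) P) {C : ℝ} (hC : 0 ≤ C)
    (h : ∀ (N : ℕ) (u : Fin (N + 1) → H), (∀ i, ‖u i‖ = 1) →
      ∫ ω, Finset.univ.sup' Finset.univ_nonempty (fun i => |⟪T ω (u i), u i⟫|) ∂P ≤ C) :
    ∫ ω, opNormH (T ω) ∂P ≤ C := by
  by_cases hint : Integrable (fun ω => opNormH (T ω)) P
  swap
  · rwa [integral_undef hint]
  obtain ⟨v, hv⟩ := exists_ne (0 : H)
  have : Nonempty (Metric.sphere (0 : H) 1) := (NormedSpace.sphere_nonempty.2 zero_le_one).to_subtype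
  obtain ⟨e, he⟩ := TopologicalSpace.exists_dense_seq (Metric.sphere (0 : H) 1)
  have he1 : ∀ k, ‖(e k : H)‖ = 1 := fun k => by simp
  set M : ℕ → Ω → ℝ := fun N ω => Finset.univ.sup' Finset.univ_nonempty
    (fun i : Fin (N + 1) => |⟪T ω (e i), (e i : H)⟫|) with hM
  have hMi : ∀ N, Integrable (M N) P := fun N => integrable_sup' fun i => (hTi _).abs
  have hle : ∀ N ω (i : Fin (N + 1)), |⟪T ω (e i), (e i : H)⟫| ≤ M N ω := fun N ω i =>
    Finset.le_sup' (fun i : Fin (N + 1) => |⟪T ω (e i), (e i : H)⟫|) (Finset.mem_univ i)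
  have hM0 : ∀ N ω, 0 ≤ M N ω := fun N ω => (abs_nonneg _).trans (hle N ω 0)
  have hMmono : ∀ ω, Monotone fun N => ENNReal.ofReal (M N ω) := fun ω N N' hN =>
    ENNReal.ofReal_le_ofReal <| Finset.sup'_le _ _ fun i _ =>
      hle N' ω (Fin.castLE (Nat.succ_le_succ hN) i)
  have hpt : ∀ ω, ENNReal.ofReal (opNormH (T ω)) ≤ ⨆ N, ENNReal.ofReal (M N ω) := fun ω => by
    rcases eq_or_ne (⨆ N, ENNReal.ofReal (M N ω)) ⊤ with htop | htop
    · rw [htop]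
      exact le_top
    · rw [← ENNReal.ofReal_toReal htop]
      refine ENNReal.ofReal_le_ofReal (opNormH_le_of_denseRange (hT ω) he fun k => ?_)
      refine (hle k ω (Fin.last k)).trans ?_
      rw [← ENNReal.toReal_ofReal (hM0 k ω)]
      exact ENNReal.toReal_mono htop (le_iSup (fun N => ENNReal.ofReal (M N ω)) k)
  rw [← ENNReal.ofReal_le_ofReal_iff hC,
    ofReal_integral_eq_lintegral_ofReal hint (.of_forall fun ω => opNormH_nonneg _)]
  refine (lintegral_mono hpt).trans ?_
  rw [lintegral_iSup' (fun N => (hMi N).aemeasurable.ennreal_ofReal) (.of_forall hMmono)]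
  refine iSup_le fun N => ?_
  rw [← ofReal_integral_eq_lintegral_ofReal (hMi N) (.of_forall (hM0 N))]
  exact ENNReal.ofReal_le_ofReal (h N (fun i => e i) fun i => he1 i)

/-- Finitely many vectors lie in the range of an isometry from a Euclidean space. -/
theorem exists_linearIsometry_range {I : Type*} [Finite I] (u : I → H) :
    ∃ (d : ℕ) (J : EuclideanSpace ℝ (Fin d) →ₗᵢ[ℝ] H) (v : I → EuclideanSpace ℝ (Fin d)),
      ∀ i, J (v i) = u i := by
  set W := Submodule.span ℝ (Set.range u)
  have : FiniteDimensional ℝ W := FiniteDimensional.span_of_finite ℝ (Set.finite_range u)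
  set b := stdOrthonormalBasis ℝ W
  refine ⟨_, W.subtypeₗᵢ.comp b.repr.symm.toLinearIsometry,
    fun i => b.repr ⟨u i, Submodule.subset_span ⟨i, rfl⟩⟩, fun i => ?_⟩
  simp

end OpNorm

section CovarianceOperators

variable {H : Type*} [NormedAddCommGroup H] [InnerProductSpace ℝ H] [CompleteSpace H]
  {σ : ℤ → ℕ → ℝ} {f g : ℤ → ℕ → H}

theorem Sig0Fun_eq (hσ0 : ∀ h i, 0 ≤ σ h i) (htrace : ∀ h, Summable (σ h))
    (hf : ∀ h, Orthonormal ℝ (f h)) (hg : ∀ h, Orthonormal ℝ (g h)) :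
    Sig0Fun σ f g = rankOneSeries (σ 0) (f 0) (g 0) :=
  funext fun u => (hasSum_rankOneSeries (hσ0 0) (htrace 0) (hf 0) (hg 0) u).tsum_eq

/-- The integrated covariance as a continuous linear map. -/
def SigBarCLM (σ : ℤ → ℕ → ℝ) (f g : ℤ → ℕ → H) (n : ℕ) : H →L[ℝ] H :=
  rankOneSeries (σ 0) (f 0) (g 0) + ∑ h ∈ Finset.Ico 1 n,
    (rankOneSeries (σ (h : ℤ)) (f h) (f h) + rankOneSeries (σ (h : ℤ)) (g h) (g h))

theorem SigBarFun_eq (hσ0 : ∀ h i, 0 ≤ σ h i) (htrace : ∀ h, Summable (σ h))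
    (hf : ∀ h, Orthonormal ℝ (f h)) (hg : ∀ h, Orthonormal ℝ (g h)) (n : ℕ) :
    SigBarFun σ f g n = SigBarCLM σ f g n := by
  ext u
  have hS : ∀ h : ℤ, (2 : ℝ) • SigTildeFun σ f g h u =
      rankOneSeries (σ h) (f h) (f h) u + rankOneSeries (σ h) (g h) (g h) u := fun h => by
    rw [← ((hasSum_rankOneSeries (hσ0 h) (htrace h) (hf h) (hf h) u).add
      (hasSum_rankOneSeries (hσ0 h) (htrace h) (hg h) (hg h) u)).tsum_eq, SigTildeFun, smul_smul]
    norm_num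
    exact tsum_congr fun i => by rw [smul_smul, smul_smul]
  simp [SigBarFun, SigBarCLM, Sig0Fun_eq hσ0 htrace hf hg, Finset.smul_sum, hS]

theorem inner_SigBarCLM (n : ℕ) (u v : H) :
    ⟪SigBarCLM σ f g n u, v⟫ = ⟪rankOneSeries (σ 0) (f 0) (g 0) u, v⟫ +
      ∑ h ∈ Finset.Ico 1 n, (⟪rankOneSeries (σ (h : ℤ)) (f h) (f h) u, v⟫ +
        ⟪rankOneSeries (σ (h : ℤ)) (g h) (g h) u, v⟫) := by
  simp [SigBarCLM, inner_add_left, sum_inner]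

theorem trSigBar_eq (σ : ℤ → ℕ → ℝ) (n : ℕ) :
    trSigBar σ n = ∑' i, σ 0 i +
      ∑ h ∈ Finset.Ico 1 n, (∑' i, σ (h : ℤ) i + ∑' i, σ (h : ℤ) i) := by
  simp only [trSigBar, trSig0, Finset.mul_sum, two_mul]

theorem norm_SigBarCLM_le (hσ0 : ∀ h i, 0 ≤ σ h i) (htrace : ∀ h, Summable (σ h))
    (hf : ∀ h, Orthonormal ℝ (f h)) (hg : ∀ h, Orthonormal ℝ (g h)) (n : ℕ) :
    ‖SigBarCLM σ f g n‖ ≤ trSigBar σ n := by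
  rw [trSigBar_eq]
  refine norm_add_le_of_le
    (norm_rankOneSeries_le (hσ0 0) (htrace 0) (hf 0) (hg 0)) (norm_sum_le_of_le _ fun h _ =>
      norm_add_le_of_le (norm_rankOneSeries_le (hσ0 _) (htrace _) (hf _) (hf _))
        (norm_rankOneSeries_le (hσ0 _) (htrace _) (hg _) (hg _)))

theorem sum_inner_SigBarCLM_le (hσ0 : ∀ h i, 0 ≤ σ h i) (htrace : ∀ h, Summable (σ h))
    (hf : ∀ h, Orthonormal ℝ (f h)) (hg : ∀ h, Orthonormal ℝ (g h)) (n : ℕ) {κ : Type*}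
    [Fintype κ] {v : κ → H} (hv : Orthonormal ℝ v) :
    ∑ j, ⟪SigBarCLM σ f g n (v j), v j⟫ ≤ trSigBar σ n := by
  simp_rw [trSigBar_eq, inner_SigBarCLM, Finset.sum_add_distrib]
  rw [Finset.sum_comm (s := Finset.univ), Finset.sum_comm (s := Finset.univ)]
  gcongr with h _ h _
  · exact sum_inner_rankOneSeries_le (hσ0 0) (htrace 0) (hf 0) (hg 0) hv
  · exact sum_inner_rankOneSeries_le (hσ0 _) (htrace _) (hf _) (hf _) hv
  · exact sum_inner_rankOneSeries_le (hσ0 _) (htrace _) (hg _) (hg _) hv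

theorem sum_Icc_one_eq_sum_fin {M : Type*} [AddCommMonoid M] (n : ℕ) (F : ℤ → M) :
    ∑ t ∈ Finset.Icc (1 : ℤ) n, F t = ∑ t : Fin n, F ((t : ℕ) + 1) := by
  rw [Fin.sum_univ_eq_sum_range (fun t => F ((t : ℤ) + 1))]
  refine Finset.sum_bij' (fun z _ => (z - 1).toNat) (fun k _ => (k : ℤ) + 1) ?_ ?_ ?_ ?_ ?_
  · intro z hz
    simp only [Finset.mem_Icc, Finset.mem_range] at *
    omega
  · intro z hz
    simp only [Finset.mem_Icc, Finset.mem_range] at *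
    omega
  · intro z hz
    simp only [Finset.mem_Icc] at *
    omega
  · intro z hz
    simp
  · intro z hz
    simp only [Finset.mem_Icc] at *
    congr 1
    omega

/-- The empirical covariance as a continuous linear map. -/
def hatSigCLM {Ω : Type*} (n : ℕ) (x : ℤ → Ω → H) (ω : Ω) : H →L[ℝ] H :=
  (1 / (n : ℝ)) • ∑ t : Fin n, (innerSL ℝ (x ((t : ℕ) + 1) ω)).smulRight (x ((t : ℕ) + 1) ω)

theorem hatSigFun_eq {Ω : Type*} (n : ℕ) (x : ℤ → Ω → H) (ω : Ω) (u : H) :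
    hatSigFun n x ω u = hatSigCLM n x ω u := by
  simp [hatSigFun, hatSigCLM, sum_Icc_one_eq_sum_fin]

theorem inner_hatSigCLM {Ω : Type*} (n : ℕ) (x : ℤ → Ω → H) (ω : Ω) (u v : H) :
    ⟪hatSigCLM n x ω u, v⟫ =
      1 / n * ∑ t : Fin n, ⟪x ((t : ℕ) + 1) ω, u⟫ * ⟪x ((t : ℕ) + 1) ω, v⟫ := by
  simp [hatSigCLM, real_inner_smul_left, sum_inner]

end CovarianceOperators

/-- Proposition 3: moment bound for the empirical covariance operator of
a Hilbert-valued dependent Gaussian process. The cross-covariance operators `Σ_h` are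
given through their singular value decompositions
`Σ_h u = Σ_i σ_i(Σ_h)⟨f_{h,i},u⟩ g_{h,i}` (trace class: `Σ_i σ_i(Σ_h) < ∞`). -/
theorem stmt9
    (H : Type*) [NormedAddCommGroup H] [InnerProductSpace ℝ H] [CompleteSpace H]
    [TopologicalSpace.SeparableSpace H]
    (Ω : Type*) [MeasureSpace Ω] [IsProbabilityMeasure (ℙ : Measure Ω)]
    (n : ℕ) (hn : 0 < n)
    -- the process
    (x : ℤ → Ω → H)
    (hgauss : IsCenteredGaussianProcess x)
    (hstat : IsCovStationary x)
    (hint : ∀ (s t : ℤ) (u v : H), Integrable (fun ω => ⟪x s ω, u⟫ * ⟪x t ω, v⟫))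
    -- singular value decompositions of the cross-covariance operators Σ_h
    (σ : ℤ → ℕ → ℝ) (f g : ℤ → ℕ → H)
    (hσ0 : ∀ h i, 0 ≤ σ h i)
    (htrace : ∀ h : ℤ, Summable (σ h))
    (hf : ∀ h : ℤ, Orthonormal ℝ (f h)) (hg : ∀ h : ℤ, Orthonormal ℝ (g h))
    (hcov : ∀ (h : ℤ) (u v : H),
      (∫ ω, ⟪x h ω, u⟫ * ⟪x 0 ω, v⟫) = ∑' i, σ h i * ⟪f h i, u⟫ * ⟪g h i, v⟫) :
    (∫ ω, opNormH (fun u => hatSigFun n x ω u - Sig0Fun σ f g u)) ≤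
      (2 * Real.sqrt 2 / n) *
        (Real.sqrt 2 * trSigBar σ n +
          Real.sqrt (2 * n * opNormH (Sig0Fun σ f g) * trSigBar σ n) +
          Real.sqrt (n * trSig0 σ * opNormH (SigBarFun σ f g n))) := by
  have : SecondCountableTopology H := UniformSpace.secondCountable_of_separable H
  have : Nontrivial H := ⟨⟨f 0 0, 0, (hf 0).ne_zero 0⟩⟩
  have hn' : (0 : ℝ) < n := by exact_mod_cast hn
  set X : Fin n → Ω → H := fun t => x ((t : ℕ) + 1) with hX
  have hXG : JointlyGaussian X := fun w => hgauss n (fun t => (t : ℕ) + 1) w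
  set K := rankOneSeries (σ 0) (f 0) (g 0) with hK
  set Q := SigBarCLM σ f g n with hQ
  have hK0 : Sig0Fun σ f g = K := Sig0Fun_eq hσ0 htrace hf hg
  have hQ0 : SigBarFun σ f g n = Q := SigBarFun_eq hσ0 htrace hf hg n
  have hform : ∀ (h : ℤ) (u v : H), ⟪rankOneSeries (σ h) (f h) (g h) u, v⟫ =
      ∫ ω, ⟪x h ω, u⟫ * ⟪x 0 ω, v⟫ := fun h u v => by
    rw [hcov, (hasSum_inner_rankOneSeries (hσ0 h) (htrace h) (hf h) (hg h) u v).tsum_eq]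
  have hKs : ∀ u v, ⟪K u, v⟫ = ⟪u, K v⟫ := fun u v => by
    rw [real_inner_comm (K v) u, hK, hform, hform]
    simp_rw [mul_comm]
  have hKnn : ∀ u, 0 ≤ ⟪K u, u⟫ := fun u => by
    rw [hK, hform]
    exact integral_nonneg fun ω => mul_self_nonneg _
  have hQs : ∀ u v, ⟪Q u, v⟫ = ⟪u, Q v⟫ := fun u v => by
    rw [real_inner_comm (Q v) u, hQ, inner_SigBarCLM, inner_SigBarCLM, ← hK, hKs, real_inner_comm]
    congr 1
    refine Finset.sum_congr rfl fun h _ => ?_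
    rw [inner_rankOneSeries_self_comm (hσ0 _) (htrace _) (hf _),
      inner_rankOneSeries_self_comm (hσ0 _) (htrace _) (hg _)]
  have hQnn : ∀ u, 0 ≤ ⟪Q u, u⟫ := fun u => by
    rw [hQ, inner_SigBarCLM]
    exact add_nonneg (hKnn u) (Finset.sum_nonneg fun h _ => add_nonneg
      (inner_rankOneSeries_self_nonneg (hσ0 _) (htrace _) (hf _) u)
      (inner_rankOneSeries_self_nonneg (hσ0 _) (htrace _) (hg _) u))
  have hXint : ∀ s t u v, Integrable (fun ω => ⟪u, X s ω⟫ * ⟪v, X t ω⟫) := fun s t u v => by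
    simpa only [real_inner_comm] using hint ((s : ℕ) + 1) ((t : ℕ) + 1) u v
  have hXsq : ∀ u t, Integrable fun ω => ⟪u, X t ω⟫ ^ 2 := fun u t => by
    simpa only [sq] using hXint t t u u
  have hXcov : ∀ (s t : Fin n) u v, ∫ ω, ⟪u, X s ω⟫ * ⟪v, X t ω⟫ =
      ∫ ω, ⟪x ((s : ℕ) - (t : ℕ) : ℤ) ω, u⟫ * ⟪x 0 ω, v⟫ := fun s t u v => by
    rw [← hstat ((t : ℕ) + 1) ((s : ℕ) - (t : ℕ)) u v,
      show ((t : ℕ) + 1 + ((s : ℕ) - (t : ℕ)) : ℤ) = (s : ℕ) + 1 by ring]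
    simp only [real_inner_comm, hX]
  have hquad : ∀ u, ∫ ω, ∑ t, ⟪u, X t ω⟫ ^ 2 = n * ⟪K u, u⟫ := fun u => by
    rw [integral_finsetSum _ fun t _ => hXsq u t]
    simp_rw [sq, hXcov, sub_self, hK, hform]
    simp
  have hdom : ∀ w : Fin n → H,
      ∫ ω, (∑ t, ⟪w t, X t ω⟫) ^ 2 ≤ ∑ t, ⟪Q (w t), w t⟫ := fun w => by
    simp_rw [sq, Finset.sum_mul_sum]
    rw [integral_finsetSum _ fun s _ => integrable_finsetSum _ fun t _ => hXint s t _ _]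
    simp_rw [integral_finsetSum _ fun t (_ : t ∈ Finset.univ) => hXint _ t _ _]
    refine (sum_sum_le_sum_diag_add_lags _
      (fun h t => ⟪rankOneSeries (σ (h : ℤ)) (f h) (f h) (w t), w t⟫)
      (fun h t => ⟪rankOneSeries (σ (h : ℤ)) (g h) (g h) (w t), w t⟫) ?_ ?_ ?_ ?_).trans_eq ?_
    · intro s t
      simp_rw [mul_comm]
    · exact fun h t => inner_rankOneSeries_self_nonneg (hσ0 _) (htrace _) (hf _) _
    · exact fun h t => inner_rankOneSeries_self_nonneg (hσ0 _) (htrace _) (hg _) _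
    · intro s t hst
      have e : (((s : ℕ) - (t : ℕ) : ℕ) : ℤ) = (s : ℕ) - (t : ℕ) := Nat.cast_sub hst.le
      rw [hXcov, ← e, ← hform]
      exact two_mul_inner_rankOneSeries_le (hσ0 _) (htrace _) (hf _) (hg _) _ _
    · refine Finset.sum_congr rfl fun t _ => ?_
      rw [hQ, inner_SigBarCLM, hXcov, sub_self, hform]
  set T := trSigBar σ n with hT
  set a := opNormH (Sig0Fun σ f g) with ha
  set b := opNormH (SigBarFun σ f g n) with hb
  have ha0 : 0 ≤ a := opNormH_nonneg _
  have hb0 : 0 ≤ b := opNormH_nonneg _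
  have hbT : b ≤ T := by
    rw [hb, hQ0]
    exact (opNormH_le_norm Q).trans (norm_SigBarCLM_le hσ0 htrace hf hg n)
  have hT0 : 0 ≤ T := hb0.trans hbT
  have htr0 : 0 ≤ trSig0 σ := tsum_nonneg (hσ0 0)
  have hKa : ∀ u, ⟪K u, u⟫ ≤ a * ‖u‖ ^ 2 := by
    rw [ha, hK0]
    exact inner_apply_self_le_opNormH K
  have hQb : ∀ u, ⟪Q u, u⟫ ≤ √b ^ 2 * ‖u‖ ^ 2 := by
    rw [Real.sq_sqrt hb0, hb, hQ0]
    exact inner_apply_self_le_opNormH Q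
  set D : Ω → H →L[ℝ] H := fun ω => hatSigCLM n x ω - K with hD
  have hDform : ∀ ω u, ⟪D ω u, u⟫ =
      1 / n * (∑ t, ⟪u, X t ω⟫ ^ 2 - ∫ ω, ∑ t, ⟪u, X t ω⟫ ^ 2) := fun ω u => by
    simp only [hquad, hD, sub_apply, inner_sub_left, inner_hatSigCLM]
    simp only [sq, real_inner_comm u, hX]
    field_simp
  have hDs : ∀ ω, (D ω : H →ₗ[ℝ] H).IsSymmetric := fun ω u v => by
    simp only [hD, ContinuousLinearMap.coe_coe, sub_apply, inner_sub_left,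
      inner_sub_right, hKs]
    rw [real_inner_comm (hatSigCLM n x ω v) u, inner_hatSigCLM, inner_hatSigCLM]
    simp_rw [mul_comm]
  have hrhs : (2 * √2 / n) * (√2 * T + √(2 * n * a * T) + √(n * trSig0 σ * b)) =
      1 / n * (4 * T + 4 * √(T * (n * a)) + 2 * √2 * (√b * √(n * trSig0 σ))) := by
    have h1 : √(2 * n * a * T) = √2 * √(T * (n * a)) := by
      rw [← Real.sqrt_mul (by norm_num)]
      congr 1
      ring
    have h2 : √(n * trSig0 σ * b) = √b * √(n * trSig0 σ) := by
      rw [← Real.sqrt_mul hb0, mul_comm]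
    have h3 : √2 * √2 = (2 : ℝ) := Real.mul_self_sqrt (by norm_num)
    rw [h1, h2]
    linear_combination (2 / n * T + 2 / n * √(T * (n * a))) * h3
  rw [hrhs]
  have hfun : ∀ ω, (fun u => hatSigFun n x ω u - Sig0Fun σ f g u) = D ω := fun ω => by
    ext u
    simp [hD, hatSigFun_eq, hK0]
  simp_rw [hfun]
  refine integral_opNormH_le hDs (fun u => ?_) (by positivity) fun N u hu => ?_
  · simp_rw [hDform]
    exact ((integrable_finsetSum _ fun t _ => hXsq u t).sub (integrable_const _)).const_mul _
  · obtain ⟨d, J, v, hv⟩ := exists_linearIsometry_range u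
    have key := integral_sup_abs_sum_sq_inner_le J hXG hQs hQnn hdom (Real.sqrt_nonneg b)
      (S := n * a) (T := T) (τ := n * trSig0 σ) (by positivity) (by rwa [Real.sq_sqrt hb0]) hQb
      (fun w hw => sum_inner_SigBarCLM_le hσ0 htrace hf hg n hw)
      (fun w => by
        rw [hquad, mul_assoc]
        exact mul_le_mul_of_nonneg_left (hKa w) hn'.le)
      (fun w hw => by
        simp_rw [hquad, ← Finset.mul_sum]
        exact mul_le_mul_of_nonneg_left
          (sum_inner_rankOneSeries_le (hσ0 0) (htrace 0) (hf 0) (hg 0) hw) hn'.le)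
      hXsq (u := v) (fun i => by rw [← J.norm_map, hv, hu])
    simp_rw [hv] at key
    have hn1 : (0 : ℝ) ≤ 1 / n := by positivity
    simp_rw [hDform, abs_mul, abs_of_nonneg hn1]
    have hpull : ∀ ω, Finset.univ.sup' Finset.univ_nonempty (fun i : Fin (N + 1) =>
        1 / (n : ℝ) * |∑ t, ⟪u i, X t ω⟫ ^ 2 - ∫ ω, ∑ t, ⟪u i, X t ω⟫ ^ 2|) =
        1 / n * Finset.univ.sup' Finset.univ_nonempty (fun i : Fin (N + 1) =>
        |∑ t, ⟪u i, X t ω⟫ ^ 2 - ∫ ω, ∑ t, ⟪u i, X t ω⟫ ^ 2|) := fun ω =>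
      (Finset.mul₀_sup' hn1 _ _ _).symm
    simp_rw [hpull]
    rw [integral_const_mul]
    exact mul_le_mul_of_nonneg_left key hn1
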